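/- Let q ∈ ℂ[x,y] be a polynomial such that the quotient ℂ-algebra ℂ[x,y]/(q) is isomorphic as a ℂ-algebra to ℂ[t], and suppose that for some coprime integers k, l ≥ 2 and some positive integer n the leading quasi-homogeneous part of q with respect to the weights (k,l) equals (x^k + y^l)^n. Then n = 1. -/

import Mathlib

section
open MvPolynomial

/-- The weighted degree of `r ∈ ℂ[x,y]` with respect to the weights `deg x = l`,
`deg y = k`: the maximum of `l·i + k·j` over monomials `x^i y^j` of `r`. -/
noncomputable def wdeg (k l : ℕ) (r : MvPolynomial (Fin 2) ℂ) : ℕ :=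
  r.weightedTotalDegree ![l, k]

/-- The leading quasi-homogeneous part of `r ∈ ℂ[x,y]` with respect to the weights
`(k, l)`: the sum of the monomials `a_{ij} x^i y^j` of `r` with `l·i + k·j` maximal. -/
noncomputable def leadingPart (k l : ℕ) (r : MvPolynomial (Fin 2) ℂ) :
    MvPolynomial (Fin 2) ℂ :=
  ∑ s ∈ r.support.filter (fun s => l * s 0 + k * s 1 = wdeg k l r),
    monomial s (coeff s r)

end

namespace AMS
open Polynomial

/-- weighted homogeneity-type filtration of coefficients -/
def Good {R : Type*} [CommRing R] [Algebra ℚ R] (B : ℕ → Submodule ℚ R) (m : ℕ) (p : R[X]) : Prop :=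
  (∀ i j, i + j = m → p.coeff j ∈ B i) ∧ ∀ j, m < j → p.coeff j = 0

section approx
variable {R : Type*} [CommRing R] [Algebra ℚ R] {B : ℕ → Submodule ℚ R}

lemma Good.mul (hB : ∀ i j a b, a ∈ B i → b ∈ B j → a * b ∈ B (i + j)) {m m' : ℕ} {p p' : R[X]}
    (h : Good B m p) (h' : Good B m' p') : Good B (m + m') (p * p') := by
  constructor
  · intro i j hij
    rw [coeff_mul]
    refine Submodule.sum_mem _ fun x hx => ?_
    rw [Finset.HasAntidiagonal.mem_antidiagonal] at hx
    by_cases h1 : m < x.1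
    · rw [h.2 _ h1]; simp
    by_cases h2 : m' < x.2
    · rw [h'.2 _ h2]; simp
    push Not at h1 h2
    have := hB (m - x.1) (m' - x.2) _ _ (h.1 (m - x.1) x.1 (by omega)) (h'.1 (m' - x.2) x.2 (by omega))
    convert this using 2
    omega
  · intro j hj
    rw [coeff_mul]
    refine Finset.sum_eq_zero fun x hx => ?_
    rw [Finset.HasAntidiagonal.mem_antidiagonal] at hx
    by_cases h1 : m < x.1
    · rw [h.2 _ h1]; simp
    · rw [h'.2 x.2 (by omega)]; simp

lemma Good.pow (hB : ∀ i j a b, a ∈ B i → b ∈ B j → a * b ∈ B (i + j)) (h1 : 1 ∈ B 0)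
    {m : ℕ} {p : R[X]} (h : Good B m p) (d : ℕ) : Good B (d * m) (p ^ d) := by
  induction d with
  | zero =>
    constructor
    · intro i j hij
      obtain ⟨rfl, rfl⟩ : i = 0 ∧ j = 0 := by omega
      simpa using h1
    · intro j hj
      have : j ≠ 0 := by omega
      simp [coeff_one, this]
  | succ d ih =>
    rw [pow_succ, Nat.succ_mul]
    exact ih.mul hB h

lemma geom_monic [Nontrivial R] {p p' : R[X]} {s : ℕ} (hp : p.Monic) (hp' : p'.Monic) (hs : p.natDegree = s)
    (hs' : p'.natDegree = s) (d : ℕ) :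
    (∀ j, (d - 1) * s < j → (∑ i ∈ Finset.range d, p ^ i * p' ^ (d - 1 - i)).coeff j = 0) ∧
    (∑ i ∈ Finset.range d, p ^ i * p' ^ (d - 1 - i)).coeff ((d - 1) * s) = d := by
  have key : ∀ i ∈ Finset.range d, (p ^ i * p' ^ (d - 1 - i)).Monic ∧
      (p ^ i * p' ^ (d - 1 - i)).natDegree = (d - 1) * s := by
    intro i hi
    rw [Finset.mem_range] at hi
    refine ⟨(hp.pow i).mul (hp'.pow _), ?_⟩
    rw [(hp.pow i).natDegree_mul (hp'.pow _), hp.natDegree_pow, hp'.natDegree_pow, hs, hs', ← add_mul]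
    congr 1; omega
  constructor
  · intro j hj
    rw [finsetSum_coeff]
    refine Finset.sum_eq_zero fun i hi => ?_
    apply coeff_eq_zero_of_natDegree_lt
    rw [(key i hi).2]; exact hj
  · rw [finsetSum_coeff]
    rw [Finset.sum_congr rfl (g := fun _ => (1 : R))]
    · simp
    · intro i hi
      have := (key i hi).1.coeff_natDegree
      rwa [(key i hi).2] at this

lemma approx_root_aux [Nontrivial R] (hB : ∀ i j a b, a ∈ B i → b ∈ B j → a * b ∈ B (i + j)) (h1 : 1 ∈ B 0)
    (d s : ℕ) (hd : 0 < d) (Q : R[X]) (hQ : Q.Monic) (hdeg : Q.natDegree = d * s)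
    (hc : Good B (d * s) Q) (r : ℕ) (hr : r ≤ s) :
    ∃ p : R[X], p.Monic ∧ p.natDegree = s ∧ Good B s p ∧
      ∀ j, d * s ≤ j + r → (Q - p ^ d).coeff j = 0 := by
  induction r with
  | zero =>
    refine ⟨X ^ s, monic_X_pow s, natDegree_X_pow s, ⟨?_, ?_⟩, ?_⟩
    · intro i j hij
      rw [coeff_X_pow]
      split_ifs with h
      · obtain rfl : i = 0 := by omega
        exact h1
      · simp
    · intro j hj
      rw [coeff_X_pow, if_neg (by omega)]
    · intro j hj
      rw [← pow_mul, mul_comm s d, coeff_sub, coeff_X_pow]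
      rcases (show d * s ≤ j by omega).eq_or_lt with h | h
      · rw [if_pos h.symm, ← h, ← hdeg, hQ.coeff_natDegree, sub_self]
      · rw [if_neg (by omega), coeff_eq_zero_of_natDegree_lt (by omega), sub_self]
  | succ r ih =>
    obtain ⟨p, hp, hps, hpg, hpc⟩ := ih (by omega)
    have hds : s ≤ d * s := Nat.le_mul_of_pos_left s hd
    set c : R := (1 / (d : ℚ)) • (Q - p ^ d).coeff (d * s - (r + 1)) with hcdef
    have hcB : c ∈ B (r + 1) := by
      refine Submodule.smul_mem _ _ ?_
      rw [coeff_sub]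
      exact Submodule.sub_mem _ (hc.1 _ _ (by omega)) ((hpg.pow hB h1 d).1 _ _ (by omega))
    set hh : R[X] := C c * X ^ (s - (r + 1)) with hhh
    have hlt : hh.degree < p.degree := by
      rw [degree_eq_natDegree hp.ne_zero, hps]
      refine lt_of_le_of_lt (degree_C_mul_X_pow_le _ _) ?_
      exact_mod_cast (by omega : s - (r+1) < s)
    have hp' : (p + hh).Monic := hp.add_of_left hlt
    have hps' : (p + hh).natDegree = s := by
      rw [natDegree_add_eq_left_of_degree_lt hlt, hps]
    refine ⟨p + hh, hp', hps', ⟨?_, ?_⟩, ?_⟩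
    · intro i j hij
      rw [coeff_add, hhh, coeff_C_mul_X_pow]
      refine Submodule.add_mem _ (hpg.1 _ _ hij) ?_
      split_ifs with h
      · obtain rfl : i = r + 1 := by omega
        exact hcB
      · simp
    · intro j hj
      exact coeff_eq_zero_of_natDegree_lt (by omega)
    · intro j hj
      have e1 : Q - (p + hh) ^ d = (Q - p ^ d) -
          (∑ i ∈ Finset.range d, (p + hh) ^ i * p ^ (d - 1 - i)) * hh := by
        have := (Commute.all (p + hh) p).geom_sum₂_mul d
        have e : p + hh - p = hh := by ring
        rw [e] at this
        rw [this]; ring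
      obtain ⟨g1, g2⟩ := geom_monic hp' hp hps' hps d
      have hds2 : d * s = (d - 1) * s + s := by
        obtain ⟨d', rfl⟩ : ∃ d', d = d' + 1 := ⟨d - 1, by omega⟩
        simp [Nat.succ_mul]
      rw [e1, coeff_sub, hhh, ← mul_assoc, coeff_mul_X_pow', if_pos (by omega), coeff_mul_C]
      rcases (show d * s ≤ j + (r + 1) from hj).eq_or_lt with h | h
      · have : j - (s - (r + 1)) = (d - 1) * s := by omega
        rw [this, g2, hcdef]
        have : j = d * s - (r + 1) := by omega
        rw [← this, mul_smul_comm, ← nsmul_eq_mul, ← Nat.cast_smul_eq_nsmul ℚ, smul_smul]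
        rw [one_div_mul_cancel (by positivity), one_smul, sub_self]
      · rw [hpc j (by omega), g1 _ (by omega), zero_mul, sub_zero]

lemma approx_root [Nontrivial R] (hB : ∀ i j a b, a ∈ B i → b ∈ B j → a * b ∈ B (i + j)) (h1 : 1 ∈ B 0)
    (d s : ℕ) (hd : 0 < d) (Q : R[X]) (hQ : Q.Monic) (hdeg : Q.natDegree = d * s)
    (hc : Good B (d * s) Q) :
    ∃ p : R[X], p.Monic ∧ p.natDegree = s ∧ Good B s p ∧
      (Q - p ^ d).degree < ((d - 1) * s : ℕ) := by
  obtain ⟨p, h1, h2, h3, h4⟩ := approx_root_aux hB h1 d s hd Q hQ hdeg hc s le_rfl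
  refine ⟨p, h1, h2, h3, ?_⟩
  rw [degree_lt_iff_coeff_zero]
  intro j hj
  apply h4
  obtain ⟨d', rfl⟩ : ∃ d', d = d' + 1 := ⟨d - 1, by omega⟩
  simp only [Nat.succ_mul, Nat.add_sub_cancel] at hj ⊢
  omega

lemma approx_root_unique {L : Type*} [Field L] [CharZero L] (d s : ℕ) (hd : 0 < d) (Q p p' : L[X])
    (hp : p.Monic) (hp' : p'.Monic) (hs : p.natDegree = s) (hs' : p'.natDegree = s)
    (h : (Q - p ^ d).degree < ((d - 1) * s : ℕ)) (h' : (Q - p' ^ d).degree < ((d - 1) * s : ℕ)) :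
    p = p' := by
  by_contra hne
  obtain ⟨g1, g2⟩ := geom_monic hp hp' hs hs' d
  have e := (Commute.all p p').geom_sum₂_mul d
  set S := ∑ i ∈ Finset.range d, p ^ i * p' ^ (d - 1 - i)
  have hS : S.natDegree = (d - 1) * s := by
    refine natDegree_eq_of_le_of_coeff_ne_zero ?_ (by rw [g2]; exact_mod_cast hd.ne')
    exact natDegree_le_iff_coeff_eq_zero.2 g1
  have hS0 : S ≠ 0 := by
    intro h0
    rw [h0] at g2
    simp at g2
    exact hd.ne (by exact_mod_cast g2)
  have h3 : (p ^ d - p' ^ d).degree < ((d - 1) * s : ℕ) := by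
    have : p ^ d - p' ^ d = (Q - p' ^ d) - (Q - p ^ d) := by ring
    rw [this]
    exact lt_of_le_of_lt (degree_sub_le _ _) (max_lt h' h)
  rw [← e, degree_mul, degree_eq_natDegree hS0, hS, degree_eq_natDegree (sub_ne_zero.2 hne)] at h3
  norm_cast at h3
  omega
end approx
end AMS

namespace AMS
open Polynomial

section bd
variable {L : Type*} [Field L] {v : AbsoluteValue L ℝ}

lemma na_sum (hv : IsNonarchimedean v) {ι : Type*} (s : Finset ι) (f : ι → L) {W : ℝ} (hW : 0 ≤ W)
    (h : ∀ i ∈ s, v (f i) ≤ W) : v (∑ i ∈ s, f i) ≤ W := by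
  classical
  induction s using Finset.induction_on with
  | empty => simpa using hW
  | insert a s ha ih =>
    rw [Finset.sum_insert ha]
    refine (hv _ _).trans (max_le (h a (by simp)) (ih fun i hi => h i (by simp [hi])))

def Bd (v : AbsoluteValue L ℝ) (ρ : ℝ) (m : ℕ) (W : ℝ) (p : L[X]) : Prop :=
  ∀ i < m, v (p.coeff i) * ρ ^ i ≤ W

variable {ρ : ℝ} {m : ℕ}

lemma Bd.add (hv : IsNonarchimedean v) (hρ : 0 < ρ) {W : ℝ} {p p' : L[X]} (h : Bd v ρ m W p) (h' : Bd v ρ m W p') :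
    Bd v ρ m W (p + p') := by
  intro i hi
  rw [coeff_add]
  refine (mul_le_mul_of_nonneg_right (hv _ _) (by positivity)).trans ?_
  rw [max_mul_of_nonneg _ _ (by positivity)]
  exact max_le (h i hi) (h' i hi)

lemma Bd.sum (hv : IsNonarchimedean v) (hρ : 0 < ρ) {W : ℝ} (hW : 0 ≤ W) {ι : Type*} (s : Finset ι) (f : ι → L[X])
    (h : ∀ i ∈ s, Bd v ρ m W (f i)) : Bd v ρ m W (∑ i ∈ s, f i) := by
  classical
  induction s using Finset.induction_on with
  | empty => intro i hi; simpa using hW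
  | insert a s ha ih =>
    rw [Finset.sum_insert ha]
    exact (h a (by simp)).add hv hρ (ih fun i hi => h i (by simp [hi]))

lemma Bd.mul (hv : IsNonarchimedean v) (hρ : 0 < ρ) {W W' : ℝ} (hW : 0 ≤ W) (hW' : 0 ≤ W') {p p' : L[X]}
    (h : Bd v ρ m W p) (h' : Bd v ρ m W' p') :
    Bd v ρ m (W * W') (p * p') := by
  intro i hi
  rw [coeff_mul, ← le_div_iff₀ (by positivity)]
  refine na_sum hv _ _ (by positivity) fun x hx => ?_
  rw [Finset.HasAntidiagonal.mem_antidiagonal] at hx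
  rw [le_div_iff₀ (by positivity), ← hx, map_mul, pow_add]
  have h1 := h x.1 (by omega)
  have h2 := h' x.2 (by omega)
  calc _ = (v (p.coeff x.1) * ρ ^ x.1) * (v (p'.coeff x.2) * ρ ^ x.2) := by ring
    _ ≤ _ := mul_le_mul h1 h2 (by positivity) hW

lemma Bd.C (_hρ : 0 < ρ) (c : L) : Bd v ρ m (v c) (Polynomial.C c) := by
  intro i hi
  rw [coeff_C]
  split_ifs with h
  · simp [h]
  · simp

lemma Bd.pow (hv : IsNonarchimedean v) (hρ : 0 < ρ) {W : ℝ} (hW : 0 ≤ W) {p : L[X]}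
    (h : Bd v ρ m W p) (d : ℕ) : Bd v ρ m (W ^ d) (p ^ d) := by
  induction d with
  | zero =>
    have := Bd.C (v := v) (m := m) hρ (1 : L)
    simpa using this
  | succ d ih => rw [pow_succ, pow_succ]; exact ih.mul hv hρ (by positivity) hW h

lemma Bd.prod (hv : IsNonarchimedean v) (hρ : 0 < ρ) {ι : Type*} (s : Finset ι) (f : ι → L[X]) (W : ι → ℝ)
    (hW : ∀ i ∈ s, 0 ≤ W i)
    (h : ∀ i ∈ s, Bd v ρ m (W i) (f i)) : Bd v ρ m (∏ i ∈ s, W i) (∏ i ∈ s, f i) := by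
  classical
  induction s using Finset.induction_on with
  | empty =>
    have := Bd.C (v := v) (m := m) hρ (1 : L)
    simpa using this
  | insert a s ha ih =>
    rw [Finset.prod_insert ha, Finset.prod_insert ha]
    exact (h a (by simp)).mul hv hρ (hW a (by simp)) (Finset.prod_nonneg fun i hi => hW i (by simp [hi]))
      (ih (fun i hi => hW i (by simp [hi])) fun i hi => h i (by simp [hi]))

lemma Bd.mono {W W' : ℝ} {p : L[X]} (h : Bd v ρ m W p) (hW : W ≤ W') : Bd v ρ m W' p :=
  fun i hi => (h i hi).trans hW

lemma Bd.X_add (hv : IsNonarchimedean v) (hρ : 0 < ρ) {u : L} (hu : ρ ≤ v u) : Bd v ρ m (v u) (X + Polynomial.C u) := by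
  refine Bd.add hv hρ ?_ (Bd.C hρ u)
  intro i hi
  rw [coeff_X]
  split_ifs with h
  · simpa [← h] using hu
  · simp

lemma Bd.div (hv : IsNonarchimedean v) (hρ : 0 < ρ) {u : L} (hu : ρ ≤ v u) {W : ℝ} (hW : 0 ≤ W) {p : L[X]}
    (h : Bd v ρ m W ((X + Polynomial.C u) * p)) : Bd v ρ m (W / v u) p := by
  have hu0 : 0 < v u := hρ.trans_le hu
  intro i hi
  induction i with
  | zero =>
    have := h 0 hi
    simp [add_mul] at this
    simp
    rw [le_div_iff₀ hu0]; linarith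
  | succ i ih =>
    have h1 := h (i + 1) hi
    have h2 := ih (by omega)
    rw [add_mul, coeff_add, coeff_X_mul, coeff_C_mul] at h1
    have e : u * p.coeff (i + 1) = (p.coeff i + u * p.coeff (i + 1)) + (- p.coeff i) := by ring
    rw [le_div_iff₀ hu0]
    calc _ = v (u * p.coeff (i+1)) * ρ ^ (i + 1) := by rw [map_mul]; ring
      _ ≤ max (v (p.coeff i + u * p.coeff (i + 1))) (v (- p.coeff i)) * ρ ^ (i + 1) := by
        have := hv (p.coeff i + u * p.coeff (i + 1)) (- p.coeff i)
        rw [← e] at this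
        exact mul_le_mul_of_nonneg_right this (by positivity)
      _ ≤ W := by
        rw [max_mul_of_nonneg _ _ (by positivity)]
        refine max_le h1 ?_
        rw [v.map_neg, pow_succ, ← mul_assoc]
        calc _ ≤ W / v u * v u := mul_le_mul h2 hu (by positivity) (by positivity)
          _ = W := by field_simp

lemma Bd.div_pow (hv : IsNonarchimedean v) (hρ : 0 < ρ) {u : L} (hu : ρ ≤ v u) (d : ℕ) {W : ℝ} (hW : 0 ≤ W) {p : L[X]}
    (h : Bd v ρ m W ((X + Polynomial.C u) ^ d * p)) : Bd v ρ m (W / v u ^ d) p := by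
  induction d generalizing W with
  | zero => simpa using h
  | succ d ih =>
    rw [pow_succ', mul_assoc] at h
    have := ih (W := W / v u) (by positivity) (h.div hv hρ hu hW)
    rwa [div_div, ← pow_succ'] at this

lemma Bd.div_prod (hv : IsNonarchimedean v) (hρ : 0 < ρ) {ι : Type*} (s : Finset ι) (u : ι → L) (hu : ∀ i ∈ s, ρ ≤ v (u i)) (d : ℕ) {W : ℝ} (hW : 0 ≤ W) {p : L[X]}
    (h : Bd v ρ m W ((∏ i ∈ s, (X + Polynomial.C (u i)) ^ d) * p)) : Bd v ρ m (W / (∏ i ∈ s, v (u i)) ^ d) p := by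
  classical
  induction s using Finset.induction_on generalizing W with
  | empty => simpa using h
  | insert a s ha ih =>
    rw [Finset.prod_insert ha, mul_assoc] at h
    have := ih (W := W / v (u a) ^ d) (fun i hi => hu i (by simp [hi])) (by positivity)
      (h.div_pow hv hρ (hu a (by simp)) d hW)
    rwa [div_div, ← mul_pow, ← Finset.prod_insert (f := fun i => v (u i)) ha] at this

/-- the ℚ-submodules -/
def ball [CharZero L] (hv : IsNonarchimedean v) (hq : ∀ r : ℚ, v (r : L) ≤ 1) (ρ : ℝ) (hρ : 0 < ρ) (i : ℕ) : Submodule ℚ L where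
  carrier := {a | v a ≤ ρ ^ i}
  add_mem' := fun ha hb => (hv _ _).trans (max_le ha hb)
  zero_mem' := by simp; positivity
  smul_mem' := fun c x hx => by
    simp only [Set.mem_ofPred_eq] at hx ⊢
    rw [Algebra.smul_def, map_mul]
    calc _ ≤ 1 * v x := mul_le_mul_of_nonneg_right (by simpa using hq c) (by positivity)
      _ ≤ _ := by simpa using hx

/-- evaluation bound -/
lemma eval_bd (hv : IsNonarchimedean v) {s : ℕ} {p : L[X]} {z : L} {W : ℝ} (hW : 0 ≤ W)
    (hdeg : p.natDegree < s) (h : ∀ j < s, v (p.coeff j) * v z ^ j ≤ W) : v (p.eval z) ≤ W := by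
  rw [eval_eq_sum_range' hdeg]
  refine na_sum hv _ _ hW fun i hi => ?_
  rw [map_mul, map_pow]
  exact h i (Finset.mem_range.1 hi)

lemma shift_bd (hv : IsNonarchimedean v) (hρ : 0 < ρ) {s : ℕ} {p : L[X]} (hdeg : p.natDegree = s)
    (h : ∀ i j, i + j = s → v (p.coeff j) ≤ ρ ^ i) {u : L} (hu : ρ ≤ v u) :
    Bd v ρ m (v u ^ s) (p.comp (X + Polynomial.C u)) := by
  have hu0 : 0 < v u := hρ.trans_le hu
  rw [comp, eval₂_eq_sum_range' _ (Nat.lt_succ_of_le hdeg.le)]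
  refine Bd.sum hv hρ (by positivity) _ _ fun j hj => ?_
  have hj : j < s + 1 := Finset.mem_range.1 hj
  refine ((Bd.C hρ _).mul hv hρ (by positivity) (by positivity) ((Bd.X_add hv hρ hu).pow hv hρ (by positivity) j)).mono ?_
  obtain ⟨i, rfl⟩ : ∃ i, s = i + j := ⟨s - j, by omega⟩
  rw [pow_add]
  refine mul_le_mul_of_nonneg_right ((h i j rfl).trans ?_) (by positivity)
  exact pow_le_pow_left₀ hρ.le hu i

end bd

end AMS

namespace AMS
open Polynomial

section core
variable {L : Type*} [Field L] {v : AbsoluteValue L ℝ} {ρ : ℝ} {m : ℕ} {ι : Type*} [Fintype ι] [DecidableEq ι]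

lemma core_val (hv : IsNonarchimedean v) (hρ : 0 < ρ) (c : ι → L) (E : ι → L[X])
    (hE : ∀ σ, (E σ).natDegree = m + 1) (hEc : ∀ σ i j, i + j = m + 1 → v ((E σ).coeff j) ≤ ρ ^ i)
    (hc : ∀ σ τ, σ ≠ τ → ρ ≤ v (c σ - c τ)) (Δ : ℝ)
    (hΔ : ∀ τ, ∏ σ ∈ Finset.univ.erase τ, v (c τ - c σ) = Δ) (hΔ0 : 0 < Δ)
    (η : L) (hη : ∀ σ, ρ ≤ v (η - c σ)) (hη2 : ∏ σ, v (η - c σ) ≤ Δ * ρ)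
    (p : L[X]) (R : ι → L[X]) (hR : ∀ σ, (R σ).degree < m)
    (hdec : ∏ σ, (E σ).comp (X - C (c σ)) = p * (∏ σ, (X - C (c σ)) ^ m) +
      ∑ τ, R τ * ∏ σ ∈ Finset.univ.erase τ, (X - C (c σ)) ^ m) : v (p.eval η) ≤ Δ * ρ := by
  have hpos : ∀ σ, 0 < v (η - c σ) := fun σ => hρ.trans_le (hη σ)
  -- bounds for R
  have hRb : ∀ τ, Bd v ρ m (Δ * ρ * ρ ^ m) ((R τ).comp (X + C (c τ))) := by
    intro τ
    have h1 := congrArg (fun r => r.comp (X + C (c τ))) hdec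
    simp only [prod_comp, add_comp, mul_comp, sum_comp, comp_assoc, sub_comp, X_comp, C_comp, pow_comp] at h1
    have e1 : ∀ σ, (X + C (c τ) - C (c σ) : L[X]) = X + C (c τ - c σ) := by
      intro σ; rw [C_sub]; ring
    simp only [e1] at h1
    -- LHS bound
    have hA : Bd v ρ m (Δ ^ (m + 1) * ρ ^ (m + 1)) (∏ σ, (E σ).comp (X + C (c τ - c σ))) := by
      rw [← Finset.prod_erase_mul _ _ (Finset.mem_univ τ), ← hΔ τ, ← Finset.prod_pow]
      refine Bd.mul hv hρ (by positivity) (by positivity) ?_ ?_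
      · refine Bd.prod hv hρ _ _ _ (fun _ _ => by positivity) ?_
        intro σ hσ
        exact shift_bd hv hρ (hE σ) (hEc σ) (hc _ _ (Finset.ne_of_mem_erase hσ).symm)
      · intro i hi
        simp only [sub_self, C_0, add_zero, comp_X]
        obtain ⟨j, hj⟩ : ∃ j, j + i = m + 1 := ⟨m + 1 - i, by omega⟩
        rw [← hj, pow_add]
        exact mul_le_mul_of_nonneg_right (hEc τ j i hj) (by positivity)
    -- X^m-divisible remainder
    have hdiv : ∃ S : L[X], ∏ σ, (E σ).comp (X + C (c τ - c σ)) =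
        (∏ σ ∈ Finset.univ.erase τ, (X + C (c τ - c σ)) ^ m) * (R τ).comp (X + C (c τ)) + S * X ^ m := by
      have h2 : ∀ σ ∈ Finset.univ.erase τ, ∃ S : L[X], (R σ).comp (X + C (c τ)) * ∏ σ' ∈ Finset.univ.erase σ, (X + C (c τ - c σ')) ^ m = S * X ^ m := by
        intro σ hσ
        have hm : τ ∈ Finset.univ.erase σ := Finset.mem_erase.2 ⟨(Finset.ne_of_mem_erase hσ).symm, Finset.mem_univ _⟩
        rw [← Finset.prod_erase_mul _ _ hm]
        simp only [sub_self, C_0, add_zero]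
        exact ⟨_, (mul_assoc _ _ _).symm⟩
      choose! S hS using h2
      have h3 : ∏ σ, (X + C (c τ - c σ) : L[X]) ^ m = (∏ σ ∈ Finset.univ.erase τ, (X + C (c τ - c σ)) ^ m) * X ^ m := by
        rw [← Finset.prod_erase_mul _ _ (Finset.mem_univ τ)]
        simp
      refine ⟨p.comp (X + C (c τ)) * (∏ σ ∈ Finset.univ.erase τ, (X + C (c τ - c σ)) ^ m) + ∑ σ ∈ Finset.univ.erase τ, S σ, ?_⟩
      rw [h1, h3, ← Finset.sum_erase_add _ _ (Finset.mem_univ τ), Finset.sum_congr rfl hS, ← Finset.sum_mul]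
      ring
    obtain ⟨S, hS⟩ := hdiv
    have hA' : Bd v ρ m (Δ ^ (m + 1) * ρ ^ (m + 1)) ((∏ σ ∈ Finset.univ.erase τ, (X + C (c τ - c σ)) ^ m) * (R τ).comp (X + C (c τ))) := by
      intro i hi
      have := hA i hi
      rw [hS, coeff_add, coeff_mul_X_pow', if_neg (by omega), add_zero] at this
      exact this
    have := hA'.div_prod hv hρ _ _ (fun σ hσ => hc _ _ (Finset.ne_of_mem_erase hσ).symm) m (by positivity)
    rw [hΔ τ] at this
    refine this.mono (le_of_eq ?_)
    field_simp; ring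
  have hRe : ∀ τ, v ((R τ).eval η) ≤ Δ * ρ * v (η - c τ) ^ m := by
    intro τ
    have h0 := hpos τ
    have e : (R τ).eval η = ((R τ).comp (X + C (c τ))).eval (η - c τ) := by
      rw [eval_comp]; simp
    by_cases hR0 : R τ = 0
    · rw [hR0]; simp; positivity
    rw [e]
    refine eval_bd (s := m) hv (by positivity) ?_ ?_
    · rw [natDegree_comp, natDegree_X_add_C, mul_one]
      exact (natDegree_lt_iff_degree_lt hR0).2 (hR τ)
    · intro j hj
      have h1 := hRb τ j hj
      obtain ⟨i, rfl⟩ : ∃ i, m = i + j := ⟨m - j, by omega⟩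
      rw [pow_add, ← mul_assoc] at h1
      have h2 := le_of_mul_le_mul_right h1 (by positivity)
      rw [pow_add, ← mul_assoc]
      refine mul_le_mul_of_nonneg_right (h2.trans ?_) (by positivity)
      exact mul_le_mul_of_nonneg_left (pow_le_pow_left₀ hρ.le (hη τ) i) (by positivity)
  -- A
  have hAe : v ((∏ σ, (E σ).comp (X - C (c σ))).eval η) ≤ Δ * ρ * ∏ σ, v (η - c σ) ^ m := by
    rw [eval_prod, map_prod]
    have h1 : ∀ σ ∈ Finset.univ, v (((E σ).comp (X - C (c σ))).eval η) ≤ v (η - c σ) * v (η - c σ) ^ m := by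
      intro σ _
      have h0 := hpos σ
      rw [eval_comp]
      simp only [eval_sub, eval_X, eval_C]
      refine eval_bd (s := m + 2) hv (by positivity) (by rw [hE]; omega) ?_
      intro j hj
      obtain ⟨i, hi⟩ : ∃ i, i + j = m + 1 := ⟨m + 1 - j, by omega⟩
      rw [← pow_succ', ← hi, pow_add]
      refine mul_le_mul_of_nonneg_right ((hEc σ i j hi).trans ?_) (by positivity)
      exact pow_le_pow_left₀ hρ.le (hη σ) i
    refine (Finset.prod_le_prod (fun _ _ => by positivity) h1).trans ?_
    rw [Finset.prod_mul_distrib]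
    exact mul_le_mul_of_nonneg_right hη2 (by positivity)
  have hfin : v (p.eval η) * ∏ σ, v (η - c σ) ^ m ≤ Δ * ρ * ∏ σ, v (η - c σ) ^ m := by
    have e : p.eval η * ∏ σ, (η - c σ) ^ m = (∏ σ, (E σ).comp (X - C (c σ))).eval η +
        (- ∑ τ, (R τ).eval η * ∏ σ ∈ Finset.univ.erase τ, (η - c σ) ^ m) := by
      rw [hdec]
      simp [eval_add, eval_mul, eval_prod, eval_finsetSum]
    have e2 : v (p.eval η) * ∏ σ, v (η - c σ) ^ m = v (p.eval η * ∏ σ, (η - c σ) ^ m) := by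
      simp [map_mul, map_prod, map_pow]
    have hP : 0 ≤ Δ * ρ * ∏ σ, v (η - c σ) ^ m := mul_nonneg (by positivity) (Finset.prod_nonneg fun σ _ => by positivity)
    rw [e2, e]
    refine (hv _ _).trans (max_le hAe ?_)
    rw [v.map_neg]
    refine na_sum hv _ _ hP fun τ _ => ?_
    rw [map_mul, map_prod, ← Finset.mul_prod_erase _ _ (Finset.mem_univ τ), ← mul_assoc]
    simp only [map_pow]
    exact mul_le_mul_of_nonneg_right (hRe τ) (Finset.prod_nonneg fun σ _ => by positivity)
  exact le_of_mul_le_mul_right hfin (Finset.prod_pos fun σ _ => pow_pos (hpos σ) _)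

end core
end AMS

namespace AMS
open Polynomial

section coredeg
variable {L : Type*} [Field L]

lemma deg_mul_iff {p q : L[X]} {a t : ℕ} (hq : IsMonicOfDegree q t) :
    (p * q).degree < ((a + t : ℕ) : WithBot ℕ) ↔ p.degree < (a : WithBot ℕ) := by
  by_cases hp : p = 0
  · simp [hp]
  · rw [degree_mul, degree_eq_natDegree hp, degree_eq_natDegree hq.monic.ne_zero, hq.natDegree_eq]
    norm_cast
    omega

lemma imd_prod {ι : Type*} (s : Finset ι) (f : ι → L[X]) (D : ℕ) (h : ∀ i ∈ s, IsMonicOfDegree (f i) D) :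
    IsMonicOfDegree (∏ i ∈ s, f i) (s.card * D) := by
  constructor
  · rw [natDegree_prod_of_monic _ _ fun i hi => (h i hi).monic, Finset.sum_congr rfl fun i hi => (h i hi).natDegree_eq]
    simp
  · exact monic_prod_of_monic _ _ fun i hi => (h i hi).monic

lemma prod_close {ι : Type*} (s : Finset ι) (T A : ι → L[X]) (D w : ℕ)
    (hT : ∀ i ∈ s, IsMonicOfDegree (T i) D) (hA : ∀ i ∈ s, IsMonicOfDegree (A i) D)
    (h : ∀ i ∈ s, ((T i - A i) * X ^ w).degree < (D : WithBot ℕ)) :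
    ((∏ i ∈ s, T i - ∏ i ∈ s, A i) * X ^ w).degree < ((s.card * D : ℕ) : WithBot ℕ) := by
  classical
  induction s using Finset.induction_on with
  | empty => simp
  | insert a s ha ih =>
    rw [Finset.prod_insert ha, Finset.prod_insert ha, Finset.card_insert_of_notMem ha]
    have e : (T a * ∏ i ∈ s, T i - A a * ∏ i ∈ s, A i) * X ^ w =
       ((T a - A a) * X ^ w) * ∏ i ∈ s, T i + (((∏ i ∈ s, T i - ∏ i ∈ s, A i) * X ^ w)) * A a := by ring
    rw [e]
    refine (degree_add_le _ _).trans_lt (max_lt ?_ ?_)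
    · rw [add_mul, one_mul, add_comm, deg_mul_iff (imd_prod s T D fun i hi => hT i (by simp [hi]))]
      exact h a (by simp)
    · rw [add_mul, one_mul, deg_mul_iff (hA a (by simp))]
      exact ih (fun i hi => hT i (by simp [hi])) (fun i hi => hA i (by simp [hi])) (fun i hi => h i (by simp [hi]))

lemma imd_comp {p : L[X]} {D : ℕ} (h : IsMonicOfDegree p D) (c : L) : IsMonicOfDegree (p.comp (X + C c)) D := by
  refine ⟨?_, h.monic.comp_X_add_C c⟩
  rw [natDegree_comp, natDegree_X_add_C, mul_one, h.natDegree_eq]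

lemma core_deg [CharZero L] {ι : Type*} [Fintype ι] [DecidableEq ι] (m d : ℕ) (hm : Fintype.card ι = m) (hm0 : 0 < m) (hd : 0 < d)
    (c : ι → L) (Q A R : ι → L[X]) (hQ : ∀ σ, IsMonicOfDegree (Q σ) d) (hA : ∀ σ, IsMonicOfDegree (A σ) (m + 1))
    (hAQ : ∀ σ, ((X - C (c σ)) ^ (m * d) * Q σ - A σ ^ d).degree < (((d - 1) * (m + 1) : ℕ) : WithBot ℕ))
    (hR : ∀ σ, (R σ).degree < (m : WithBot ℕ)) (p p₀ : L[X])
    (hp : IsMonicOfDegree p m) (hpQ : (∏ σ, Q σ - p ^ d).degree < (((d - 1) * m : ℕ) : WithBot ℕ))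
    (hdec : ∏ σ, A σ = p₀ * (∏ σ, (X - C (c σ)) ^ m) +
      ∑ τ, R τ * ∏ σ ∈ Finset.univ.erase τ, (X - C (c σ)) ^ m) : p = p₀ := by
  obtain ⟨d, rfl⟩ : ∃ d', d = d' + 1 := ⟨d - 1, by omega⟩
  obtain ⟨m', hm'⟩ : ∃ m', m = m' + 1 := ⟨m - 1, by omega⟩
  simp only [Nat.add_sub_cancel] at *
  set S := ∑ τ, R τ * ∏ σ ∈ Finset.univ.erase τ, (X - C (c σ)) ^ m with hSdef
  set P := ∏ σ, (X - C (c σ)) ^ m with hPdef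
  have hX : ∀ σ, ∀ r, IsMonicOfDegree ((X - C (c σ)) ^ r) r := fun σ r => by
    simpa using (isMonicOfDegree_X_sub_one (c σ)).pow r
  have hP : IsMonicOfDegree P (m * m) := by
    have := imd_prod Finset.univ _ m fun σ _ => hX σ m
    rwa [Finset.card_univ, hm] at this
  have hAA : IsMonicOfDegree (∏ σ, A σ) (m * (m + 1)) := by
    have := imd_prod Finset.univ _ _ fun σ _ => hA σ
    rwa [Finset.card_univ, hm] at this
  have hS : S.degree < ((m * m : ℕ) : WithBot ℕ) := by
    rw [hSdef]
    refine (degree_sum_le _ _).trans_lt ?_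
    rw [Finset.sup_lt_iff (WithBot.bot_lt_coe _)]
    intro τ _
    have h1 := imd_prod (Finset.univ.erase τ) _ m fun σ _ => hX σ m
    rw [Finset.card_erase_of_mem (Finset.mem_univ _), Finset.card_univ, hm] at h1
    have h2 := (deg_mul_iff (p := R τ) (a := m) h1).2 (hR τ)
    convert h2 using 2
    subst hm'
    simp; ring
  have hPA : IsMonicOfDegree (p₀ * P) (m * (m + 1)) := by
    have : p₀ * P = ∏ σ, A σ - S := by rw [hdec]; ring
    rw [this]
    have hlt : S.degree < (∏ σ, A σ).degree := by
      rw [degree_eq_natDegree hAA.monic.ne_zero, hAA.natDegree_eq]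
      refine hS.trans_le ?_
      exact_mod_cast (by nlinarith)
    refine ⟨?_, hAA.monic.sub_of_left hlt⟩
    rw [natDegree_eq_of_degree_eq (degree_sub_eq_left_of_degree_lt hlt), hAA.natDegree_eq]
  have hp₀ : IsMonicOfDegree p₀ m := by
    have h1 : p₀.Monic := hP.monic.of_mul_monic_right hPA.monic
    refine ⟨?_, h1⟩
    have := hPA.natDegree_eq
    rw [h1.natDegree_mul hP.monic, hP.natDegree_eq] at this
    nlinarith
  refine approx_root_unique (d + 1) m (by omega) (∏ σ, Q σ) p p₀ hp.monic hp₀.monic hp.natDegree_eq hp₀.natDegree_eq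
    (by simpa using hpQ) ?_
  have hPd := hP.pow (d + 1)
  rw [Nat.add_sub_cancel, ← deg_mul_iff hPd]
  have e : (∏ σ, Q σ - p₀ ^ (d + 1)) * P ^ (d + 1) =
      (∏ σ, ((X - C (c σ)) ^ (m * (d + 1)) * Q σ) - ∏ σ, (A σ) ^ (d + 1)) +
      (((∏ σ, A σ) ^ (d + 1)) - (p₀ * P) ^ (d + 1)) := by
    rw [Finset.prod_mul_distrib, Finset.prod_pow, mul_pow, hPdef, Finset.prod_pow, Finset.prod_pow]
    ring
  rw [e]
  refine (degree_add_le _ _).trans_lt (max_lt ?_ ?_)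
  · have h1 := prod_close Finset.univ (fun σ => ((X - C (c σ)) ^ (m * (d + 1)) * Q σ)) (fun σ => (A σ) ^ (d + 1)) ((d+1) * (m + 1)) (m + 1)
      (fun σ _ => by
        have := (hX σ (m * (d + 1))).mul (hQ σ)
        convert this using 1; ring)
      (fun σ _ => by
        have := (hA σ).pow (d + 1)
        convert this using 1; ring)
      (fun σ _ => by
        rw [add_mul, one_mul, deg_mul_iff (isMonicOfDegree_X_pow _ _)]
        exact hAQ σ)
    rw [Finset.card_univ, hm] at h1
    have h2 : m * ((d + 1) * (m + 1)) = ((d * m + m * m * (d + 1)) - 1) + (m + 1) := by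
      have : 0 < m * m * (d + 1) := by positivity
      zify [show 1 ≤ d * m + m * m * (d + 1) by omega]
      ring
    rw [h2, deg_mul_iff (isMonicOfDegree_X_pow _ _)] at h1
    exact h1.trans_le (by exact_mod_cast Nat.sub_le _ _)
  · obtain ⟨g1, -⟩ := geom_monic hAA.monic hPA.monic hAA.natDegree_eq hPA.natDegree_eq (d + 1)
    rw [← (Commute.all (∏ σ, A σ) (p₀ * P)).geom_sum₂_mul (d + 1)]
    have e2 : ∏ σ, A σ - p₀ * P = S := by rw [hdec]; ring
    rw [e2]
    by_cases hS0 : S = 0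
    · rw [hS0, mul_zero, degree_zero]; exact WithBot.bot_lt_coe _
    refine (degree_mul_le _ _).trans_lt ?_
    have hg : (∑ i ∈ Finset.range (d + 1), (∏ σ, A σ) ^ i * (p₀ * P) ^ (d + 1 - 1 - i)).degree ≤ ((d * (m * (m + 1)) : ℕ) : WithBot ℕ) := by
      rw [degree_le_iff_coeff_zero]
      intro j hj
      apply g1
      simpa using (by exact_mod_cast hj : d * (m * (m + 1)) < j)
    rw [degree_eq_natDegree hS0] at hS ⊢
    have hS' : S.natDegree < m * m := by exact_mod_cast hS
    calc _ ≤ ((d * (m * (m + 1)) : ℕ) : WithBot ℕ) + (S.natDegree : WithBot ℕ) := by gcongr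
      _ < _ := by
        norm_cast
        nlinarith

theorem core [CharZero L] {v : AbsoluteValue L ℝ} {ρ : ℝ} {ι : Type*} [Fintype ι] [DecidableEq ι] [Nonempty ι]
    (hv : IsNonarchimedean v) (hq : ∀ r : ℚ, v (r : L) ≤ 1) (hρ : 0 < ρ) (d : ℕ) (hd : 0 < d)
    (c : ι → L) (Q : ι → L[X]) (hQ : ∀ σ, IsMonicOfDegree (Q σ) d)
    (hQc : ∀ σ i j, i + j = d → v (((Q σ).comp (X + C (c σ))).coeff j) ≤ ρ ^ i)
    (hc : ∀ σ τ, σ ≠ τ → ρ ≤ v (c σ - c τ)) (Δ : ℝ)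
    (hΔ : ∀ τ, ∏ σ ∈ Finset.univ.erase τ, v (c τ - c σ) = Δ) (hΔ0 : 0 < Δ)
    (η : L) (hη : ∀ σ, ρ ≤ v (η - c σ)) (hη2 : ∏ σ, v (η - c σ) ≤ Δ * ρ)
    (p : L[X]) (hp : IsMonicOfDegree p (Fintype.card ι))
    (hpQ : (∏ σ, Q σ - p ^ d).degree < (((d - 1) * Fintype.card ι : ℕ) : WithBot ℕ)) : v (p.eval η) ≤ Δ * ρ := by
  set m := Fintype.card ι with hm
  have hB : ∀ i j a b, a ∈ ball hv hq ρ hρ i → b ∈ ball hv hq ρ hρ j → a * b ∈ ball hv hq ρ hρ (i + j) := by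
    intro i j a b ha hb
    change v a ≤ ρ ^ i at ha
    change v b ≤ ρ ^ j at hb
    change v (a * b) ≤ ρ ^ (i + j)
    rw [map_mul, pow_add]
    exact mul_le_mul ha hb (by positivity) (by positivity)
  have h1 : (1 : L) ∈ ball hv hq ρ hρ 0 := by
    change v 1 ≤ ρ ^ 0
    simp
  have hE : ∀ σ, ∃ E : L[X], E.Monic ∧ E.natDegree = m + 1 ∧ Good (ball hv hq ρ hρ) (m + 1) E ∧
      (X ^ (m * d) * (Q σ).comp (X + C (c σ)) - E ^ d).degree < (((d - 1) * (m + 1) : ℕ) : WithBot ℕ) := by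
    intro σ
    have hQ' : IsMonicOfDegree (X ^ (m * d) * (Q σ).comp (X + C (c σ))) (d * (m + 1)) := by
      have := (isMonicOfDegree_X_pow L (m * d)).mul (imd_comp (hQ σ) (c σ))
      convert this using 1; ring
    refine approx_root hB h1 d (m + 1) hd _ hQ'.monic hQ'.natDegree_eq ⟨?_, ?_⟩
    · intro i j hij
      change v _ ≤ ρ ^ i
      rw [coeff_X_pow_mul']
      split_ifs with h
      · refine hQc σ i (j - m * d) ?_
        have : d * (m + 1) = m * d + d := by ring
        omega
      · simp; positivity
    · intro j hj
      exact coeff_eq_zero_of_natDegree_lt (by rw [hQ'.natDegree_eq]; exact hj)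
  choose E hE1 hE2 hE3 hE4 using hE
  have hcop : Set.Pairwise ((Finset.univ : Finset ι) : Set ι) fun i j => IsCoprime ((X - C (c i)) ^ m) ((X - C (c j)) ^ m) := by
    intro σ _ τ _ hστ
    refine IsCoprime.pow (isCoprime_X_sub_C_of_isUnit_sub ?_)
    refine IsUnit.mk0 _ ?_
    intro h0
    have := hc σ τ hστ
    rw [h0, map_zero] at this
    linarith
  obtain ⟨p₀, R, hR, hdec⟩ := eq_quo_mul_prod_add_sum_rem_mul_prod (s := Finset.univ) (∏ σ, (E σ).comp (X - C (c σ)))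
    (fun σ _ => (monic_X_sub_C (c σ)).pow m) hcop
  have hR' : ∀ σ, (R σ).degree < (m : WithBot ℕ) := by
    intro σ
    have := hR σ (Finset.mem_univ _)
    rwa [degree_pow, degree_X_sub_C, nsmul_one] at this
  have hval := core_val hv hρ c E hE2 (fun σ => (hE3 σ).1) hc Δ hΔ hΔ0 η hη hη2 p₀ R hR' hdec
  have hsub : ∀ σ, (X - C (c σ) : L[X]) = X + C (- c σ) := by intro σ; simp [sub_eq_add_neg]
  have : p = p₀ := by
    refine core_deg m d hm.symm Fintype.card_pos hd c Q (fun σ => (E σ).comp (X - C (c σ))) R hQ ?_ ?_ hR' p p₀ hp hpQ hdec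
    · intro σ
      rw [hsub]
      exact imd_comp ⟨hE2 σ, hE1 σ⟩ _
    · intro σ
      have := hE4 σ
      rw [← degree_taylor _ (- c σ), taylor_apply, ← hsub] at this
      convert this using 2
      simp [comp_assoc]
  rw [this]; exact hval

end coredeg
end AMS

namespace AMS
open Polynomial

section tele

lemma tele {G : Type*} (T : Finset G) (δ : G → ℤ)
    (hyp : ∀ z ∈ T, 0 ≤ ∑ x ∈ T with δ z < δ x, δ x + (1 + ((T.filter fun x => δ x ≤ δ z).card : ℤ)) * δ z) (v : ℤ) (m : ℕ) :
    (∑ x ∈ T with v < δ x, δ x : ℤ) * (1 + ((T.filter fun x => δ x ≤ v - m).card : ℤ)) ≤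
    (∑ x ∈ T with v - m < δ x, δ x : ℤ) * (1 + ((T.filter fun x => δ x ≤ v).card : ℤ)) := by
  classical
  induction m with
  | zero => simp
  | succ m ih =>
    set w := v - (m : ℤ) with hw
    have hw' : v - ((m + 1 : ℕ) : ℤ) = w - 1 := by push_cast; omega
    rw [hw']
    set E := T.filter fun x => δ x = w with hE
    have hc : (T.filter fun x => δ x ≤ w).card = (T.filter fun x => δ x ≤ w - 1).card + E.card := by
      rw [← Finset.card_union_of_disjoint]
      · congr 1; ext x; simp only [hE, Finset.mem_filter, Finset.mem_union, ← and_or_left];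
        constructor
        · rintro ⟨a, b⟩; exact ⟨a, by omega⟩
        · rintro ⟨a, b⟩; exact ⟨a, by omega⟩
      · rw [Finset.disjoint_left]; intro x; simp only [hE, Finset.mem_filter]; rintro ⟨-, a⟩ ⟨-, b⟩; omega
    have hs : ∑ x ∈ T with w - 1 < δ x, δ x = ∑ x ∈ T with w < δ x, δ x + E.card * w := by
      have : (T.filter fun x => w - 1 < δ x) = (T.filter fun x => w < δ x) ∪ E := by
        ext x; simp only [hE, Finset.mem_filter, Finset.mem_union, ← and_or_left];
        constructor
        · rintro ⟨a, b⟩; exact ⟨a, by omega⟩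
        · rintro ⟨a, b⟩; exact ⟨a, by omega⟩
      rw [this, Finset.sum_union]
      · congr 1
        rw [Finset.sum_congr rfl (g := fun _ => w)]
        · simp
        · intro x hx; exact (Finset.mem_filter.1 hx).2
      · rw [Finset.disjoint_left]; intro x; simp only [hE, Finset.mem_filter]; rintro ⟨-, a⟩ ⟨-, b⟩; omega
    rw [hc] at ih
    rw [hs]
    rcases E.eq_empty_or_nonempty with h0 | ⟨z, hz⟩
    · simpa [h0] using ih
    · have hz' := Finset.mem_filter.1 hz
      have h1 := hyp z hz'.1
      rw [hz'.2, hc] at h1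
      push_cast at ih h1
      set Sw := ∑ x ∈ T with w < δ x, δ x
      set Sv := ∑ x ∈ T with v < δ x, δ x
      set a := ((T.filter fun x => δ x ≤ w - 1).card : ℤ)
      set b := ((T.filter fun x => δ x ≤ v).card : ℤ)
      have ha : 0 ≤ a := by positivity
      have hb : 0 ≤ b := by positivity
      set e := (E.card : ℤ)
      have he : 0 ≤ e := by positivity
      -- Sv (1+a+e) ≤ Sw (1+b), 0 ≤ Sw + (1+a+e) w
      have h2 : Sv * (1 + a) * (1 + (a + e)) ≤ (Sw + e * w) * (1 + b) * (1 + (a + e)) := by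
        nlinarith [mul_le_mul_of_nonneg_right ih (show 0 ≤ 1 + a by linarith), mul_nonneg (mul_nonneg he (show 0 ≤ 1 + b by linarith)) h1]
      exact le_of_mul_le_mul_right h2 (by linarith)
end tele

section grp
variable {L : Type*} [Field L] {v : AbsoluteValue L ℝ}

lemma na_eq (hv : IsNonarchimedean v) {a b : L} (h : v b < v a) : v (a + b) = v a := by
  apply le_antisymm
  · exact (hv a b).trans (max_le le_rfl h.le)
  · have := hv (a + b) (-b)
    rw [add_neg_cancel_right, v.map_neg] at this
    rcases le_max_iff.1 this with h1 | h1
    · exact h1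
    · linarith

variable {G : Type*} [Group G] [MulSemiringAction G L]

def Hs (hv : IsNonarchimedean v) (hG : ∀ (g : G) (a : L), v (g • a) = v a) (y : L) (ρ : ℝ) (hρ : 0 < ρ) : Subgroup G where
  carrier := {g | v (y - g • y) ≤ ρ}
  one_mem' := by simpa using hρ.le
  mul_mem' := by
    intro a b ha hb
    change v _ ≤ _ at ha hb ⊢
    have : y - (a * b) • y = (y - a • y) + a • (y - b • y) := by
      rw [smul_sub, mul_smul]; ring
    rw [this]
    exact (hv _ _).trans (max_le ha (by rwa [hG]))
  inv_mem' := by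
    intro a ha
    change v _ ≤ _ at ha ⊢
    have : y - a⁻¹ • y = - (a⁻¹ • (y - a • y)) := by
      rw [smul_sub, inv_smul_smul]; ring
    rwa [this, v.map_neg, hG]

lemma prod_split {G : Type*} [Group G] [Fintype G] (H : Subgroup G) [Fintype H] [Fintype (G ⧸ H)] {M : Type*} [CommMonoid M]
    (F : G → M) : ∏ g, F g = ∏ σ : G ⧸ H, ∏ h : H, F (σ.out * h) := by
  rw [← Fintype.prod_prod_type']
  symm
  refine Function.Bijective.prod_comp (e := fun x : (G ⧸ H) × H => x.1.out * (x.2 : G)) ⟨?_, ?_⟩ F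
  · rintro ⟨σ, h⟩ ⟨τ, k⟩ e
    simp only at e
    have h1 := congrArg (QuotientGroup.mk (s := H)) e
    rw [QuotientGroup.mk_mul_of_mem _ h.2, QuotientGroup.mk_mul_of_mem _ k.2] at h1
    simp only [QuotientGroup.out_eq'] at h1
    subst h1
    have h2 := mul_left_cancel e
    rw [Prod.mk.injEq]
    exact ⟨rfl, Subtype.ext h2⟩
  · intro g
    refine ⟨((g : G ⧸ H), ⟨(g : G ⧸ H).out⁻¹ * g, ?_⟩), by simp⟩
    rw [← QuotientGroup.eq]
    simp

theorem group_step [CharZero L] [Fintype G] [DecidableEq G]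
    (hv : IsNonarchimedean v) (hq : ∀ r : ℚ, v (r : L) ≤ 1) (hG : ∀ (g : G) (a : L), v (g • a) = v a) (y : L)
    (happ : ∀ d e, d * e = Fintype.card G → 1 < d → ∃ p : L[X], IsMonicOfDegree p e ∧
      (∏ g : G, (X - C (g • y)) - p ^ d).degree < (((d - 1) * e : ℕ) : WithBot ℕ) ∧ ∀ g : G, 1 ≤ v (p.eval (g • y)))
    (z : G) (hz : z • y ≠ y) :
    1 ≤ (∏ g : G with v (y - z • y) < v (y - g • y), v (y - g • y)) * v (y - z • y) ^ (Finset.univ.filter fun g : G => v (y - g • y) ≤ v (y - z • y)).card := by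
  classical
  set ρ := v (y - z • y) with hρdef
  have hρ : 0 < ρ := v.pos (sub_ne_zero.2 hz.symm)
  set H := Hs hv hG y ρ hρ with hH
  have hmem : ∀ g, g ∈ H ↔ v (y - g • y) ≤ ρ := fun g => Iff.rfl
  set d := Fintype.card H with hd
  have hdcard : (Finset.univ.filter fun g : G => v (y - g • y) ≤ ρ).card = d := by
    rw [hd, Fintype.card_subtype]
    rfl
  have hd1 : 1 < d := by
    rw [hd, Fintype.one_lt_card_iff]
    refine ⟨1, ⟨z, (hmem z).2 le_rfl⟩, ?_⟩
    intro h
    have : z = 1 := (congrArg Subtype.val h).symm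
    exact hz (by rw [this, one_smul])
  let ι := G ⧸ H
  let c : ι → L := fun σ => σ.out • y
  have hdiff : ∀ g g' : G, v (g • y - g' • y) = v (y - (g⁻¹ * g') • y) := by
    intro g g'
    rw [← hG g⁻¹, smul_sub, inv_smul_smul, mul_smul]
  have hout : ∀ σ τ : ι, σ ≠ τ → ρ < v (c σ - c τ) := by
    intro σ τ h
    change ρ < v (σ.out • y - τ.out • y)
    rw [hdiff]
    by_contra h'
    push Not at h'
    rw [← hmem, ← QuotientGroup.eq] at h'
    apply h
    simpa using h'
  have hsmall : ∀ (g : G) (h : H), v (g • y - (g * h) • y) ≤ ρ := by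
    intro g h
    rw [hdiff, inv_mul_cancel_left]
    exact (hmem _).1 h.2
  have hcard : d * Fintype.card ι = Fintype.card G := by
    have h1 := H.card_eq_card_quotient_mul_card_subgroup
    simp only [Nat.card_eq_fintype_card] at h1
    rw [h1, mul_comm]
  obtain ⟨p, hp, hpQ, hpv⟩ := happ d (Fintype.card ι) hcard hd1
  rw [prod_split H] at hpQ
  set Q : ι → L[X] := fun σ => ∏ h : H, (X - C ((σ.out * h) • y)) with hQdef
  have hW : ∀ τ : ι, ∏ g : G with ρ < v (y - g • y), v (y - g • y) = (∏ σ ∈ Finset.univ.erase τ, v (c τ - c σ)) ^ d := by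
    intro τ
    rw [Finset.prod_filter, ← Equiv.prod_comp (Equiv.mulLeft τ.out⁻¹)]
    simp only [Equiv.coe_mulLeft, ← hdiff]
    rw [prod_split H, ← Finset.prod_erase_mul _ _ (Finset.mem_univ τ), ← Finset.prod_pow]
    rw [Finset.prod_eq_one (s := (Finset.univ : Finset H)), mul_one]
    · refine Finset.prod_congr rfl fun σ hσ => ?_
      rw [hd, ← Finset.card_univ, ← Finset.prod_const]
      refine Finset.prod_congr rfl fun h _ => ?_
      have h1 := hout τ σ (Finset.ne_of_mem_erase hσ).symm
      have h2 : v (τ.out • y - (σ.out * h) • y) = v (c τ - c σ) := by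
        have e : τ.out • y - (σ.out * h) • y = (c τ - c σ) + (σ.out • y - (σ.out * h) • y) := by
          simp only [c]; ring
        rw [e]
        exact na_eq hv ((hsmall _ _).trans_lt h1)
      rw [h2, if_pos h1]
    · intro h _
      rw [if_neg]
      exact not_lt.2 (hsmall _ _)
  have hpos : ∀ τ : ι, 0 < ∏ σ ∈ Finset.univ.erase τ, v (c τ - c σ) := fun τ =>
    Finset.prod_pos fun σ hσ => hρ.trans (hout τ σ (Finset.ne_of_mem_erase hσ).symm)
  let τ₀ : ι := ((1 : G) : G ⧸ H)
  set Δ := ∏ σ ∈ Finset.univ.erase τ₀, v (c τ₀ - c σ) with hΔ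
  have hΔeq : ∀ τ, ∏ σ ∈ Finset.univ.erase τ, v (c τ - c σ) = Δ := by
    intro τ
    have := (hW τ).symm.trans (hW τ₀)
    exact (pow_left_inj₀ (hpos τ).le (hpos τ₀).le (by omega)).1 this
  set η := (τ₀.out * z) • y with hη
  have hη0 : v (η - c τ₀) = ρ := by
    rw [v.map_sub, hdiff, inv_mul_cancel_left]
  have hη1 : ∀ σ, σ ≠ τ₀ → v (η - c σ) = v (c τ₀ - c σ) := by
    intro σ hσ
    have e : η - c σ = (c τ₀ - c σ) + (η - c τ₀) := by ring
    rw [e]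
    exact na_eq hv (by rw [hη0]; exact hout _ _ hσ.symm)
  have hfin := core hv hq hρ d (by omega) c Q ?_ ?_ (fun σ τ h => (hout σ τ h).le) Δ hΔeq (hpos τ₀) η ?_ ?_ p hp hpQ
  · rw [hW τ₀, hdcard, ← mul_pow]
    exact one_le_pow₀ ((hpv _).trans hfin)
  · intro σ
    have := imd_prod (Finset.univ : Finset H) (fun h : H => (X - C ((σ.out * h) • y))) 1 fun h _ => isMonicOfDegree_X_sub_one _
    rwa [Finset.card_univ, mul_one] at this
  · intro σ i j hij
    have h1 : Bd v ρ (d + 1) (∏ h : H, ρ) ((Q σ).comp (X + C (c σ))) := by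
      rw [hQdef, prod_comp]
      refine Bd.prod hv hρ _ _ _ (fun _ _ => hρ.le) fun h _ => ?_
      have e : (X - C ((σ.out * h) • y) : L[X]).comp (X + C (c σ)) = X + C (σ.out • y - (σ.out * h) • y) := by
        simp only [sub_comp, X_comp, C_comp, c, C_sub]; ring
      rw [e]
      refine Bd.add hv hρ ?_ ((Bd.C hρ _).mono (hsmall _ _))
      intro i hi
      rw [coeff_X]
      split_ifs with h
      · simp [← h]
      · simpa using hρ.le
    have h2 := h1 j (by omega)
    rw [Finset.prod_const, Finset.card_univ, ← hd, ← hij, pow_add] at h2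
    exact le_of_mul_le_mul_right h2 (by positivity)
  · intro σ
    by_cases h : σ = τ₀
    · rw [h, hη0]
    · rw [hη1 σ h]; exact (hout _ _ (Ne.symm h)).le
  · rw [← Finset.prod_erase_mul _ _ (Finset.mem_univ τ₀), hη0, hΔ]
    refine le_of_eq ?_
    congr 1
    exact Finset.prod_congr rfl fun σ hσ => hη1 σ (Finset.ne_of_mem_erase hσ)
end grp
end AMS

namespace AMS
open Polynomial

section laurent

abbrev LL := HahnSeries ℤ ℂ

instance : CharZero LL := charZero_of_injective_algebraMap (algebraMap ℂ LL).injective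

open Classical in
/-- the absolute value -/
noncomputable def vL : AbsoluteValue LL ℝ where
  toFun a := if a = 0 then 0 else (2 : ℝ) ^ (- a.order)
  map_mul' a b := by
    by_cases ha : a = 0
    · simp [ha]
    by_cases hb : b = 0
    · simp [hb]
    rw [if_neg ha, if_neg hb, if_neg (mul_ne_zero ha hb), HahnSeries.order_mul ha hb, neg_add, zpow_add₀ (by norm_num)]
  nonneg' a := by
    split_ifs
    · exact le_rfl
    · positivity
  eq_zero' a := by
    split_ifs with h
    · simp [h]
    · simp only [h, iff_false]; positivity
  add_le' a b := by
    by_cases ha : a = 0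
    · simp [ha]
    by_cases hb : b = 0
    · simp [hb]
    by_cases hab : a + b = 0
    · rw [if_neg ha, if_neg hb, if_pos hab]; positivity
    rw [if_neg ha, if_neg hb, if_neg hab]
    have h := HahnSeries.min_order_le_order_add hab
    have p1 : (0 : ℝ) < 2 ^ (- a.order) := by positivity
    have p2 : (0 : ℝ) < 2 ^ (- b.order) := by positivity
    rcases min_le_iff.1 h with h | h
    · have : (2 : ℝ) ^ (- (a + b).order) ≤ 2 ^ (- a.order) := zpow_le_zpow_right₀ (by norm_num) (by omega)
      linarith
    · have : (2 : ℝ) ^ (- (a + b).order) ≤ 2 ^ (- b.order) := zpow_le_zpow_right₀ (by norm_num) (by omega)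
      linarith

lemma vL_eq {a : LL} (ha : a ≠ 0) : vL a = (2 : ℝ) ^ (- a.order) := if_neg ha

lemma vL_na : IsNonarchimedean vL := by
  intro a b
  by_cases ha : a = 0
  · simp [ha]
  by_cases hb : b = 0
  · simp [hb]
  by_cases hab : a + b = 0
  · rw [hab]; simp
  rw [vL_eq ha, vL_eq hb, vL_eq hab]
  have h := HahnSeries.min_order_le_order_add hab
  rw [le_max_iff]
  rcases min_le_iff.1 h with h | h
  · left; exact zpow_le_zpow_right₀ (by norm_num) (by omega)
  · right; exact zpow_le_zpow_right₀ (by norm_num) (by omega)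

lemma algMap_eq (c : ℂ) : algebraMap ℂ LL c = HahnSeries.single 0 c := by
  rw [HahnSeries.algebraMap_apply']
  exact HahnSeries.ofPowerSeries_C c

lemma vL_C {c : ℂ} (hc : c ≠ 0) : vL (algebraMap ℂ LL c) = 1 := by
  have h : algebraMap ℂ LL c = HahnSeries.single 0 c := by
    exact algMap_eq c
  rw [h, vL_eq (by simpa using hc), HahnSeries.order_single hc]; simp

lemma vL_rat (r : ℚ) : vL (r : LL) ≤ 1 := by
  by_cases h : r = 0
  · simp [h]
  · have : (r : LL) = algebraMap ℂ LL (r : ℂ) := by simp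
    rw [this, vL_C (by exact_mod_cast h)]

/-- the automorphism `s ↦ ζ s` -/
noncomputable def act (z : ℂˣ) (a : LL) : LL where
  coeff j := (z ^ j : ℂˣ) * a.coeff j
  isPWO_support' := a.isPWO_support.mono (by
    intro j hj
    simp only [Function.mem_support] at hj
    exact right_ne_zero_of_mul hj)

lemma act_coeff (z : ℂˣ) (a : LL) (j : ℤ) : (act z a).coeff j = (z ^ j : ℂˣ) * a.coeff j := rfl

lemma act_support (z : ℂˣ) (a : LL) : (act z a).support = a.support := by
  ext j
  rw [HahnSeries.mem_support, HahnSeries.mem_support, act_coeff]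
  simp only [ne_eq, mul_eq_zero, Units.ne_zero, false_or]

lemma act_mul (z : ℂˣ) (a b : LL) : act z (a * b) = act z a * act z b := by
  ext j
  rw [act_coeff, HahnSeries.coeff_mul, HahnSeries.coeff_mul, Finset.mul_sum]
  refine Finset.sum_congr ?_ ?_
  · ext x
    simp only [Finset.mem_antidiagonal, act_support]
  · intro x hx
    have h : x.1 + x.2 = j := by
      have := Finset.mem_antidiagonal.1 hx
      simp_all
    rw [act_coeff, act_coeff, ← h, zpow_add]
    push_cast
    ring

/-- wrapper type for the group of roots of unity -/
def MU (a : ℕ) : Type := rootsOfUnity a ℂ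

instance (a : ℕ) : CommGroup (MU a) := inferInstanceAs (CommGroup (rootsOfUnity a ℂ))
noncomputable instance (a : ℕ) [NeZero a] : Fintype (MU a) := Fintype.ofFinite (rootsOfUnity a ℂ)

lemma card_MU (a : ℕ) [NeZero a] : Fintype.card (MU a) = a := by
  rw [← Nat.card_eq_fintype_card]; exact Complex.card_rootsOfUnity a


def MU.val {a : ℕ} : MU a →* ℂˣ := (rootsOfUnity a ℂ).subtype

noncomputable instance actG (a : ℕ) : MulSemiringAction (MU a) LL where
  smul z := act z.val
  one_smul a := by ext j; change (act (MU.val 1) a).coeff j = _; simp [act_coeff]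
  mul_smul z w a := by
    ext j; change (act (z * w).val a).coeff j = (act z.val (act w.val a)).coeff j
    simp [act_coeff, mul_zpow, mul_assoc]
  smul_zero z := by ext j; change (act z.val 0).coeff j = _; simp [act_coeff]
  smul_add z a b := by
    ext j; change (act z.val (a + b)).coeff j = (act z.val a + act z.val b).coeff j
    simp [act_coeff, mul_add]
  smul_one z := by
    ext j; change (act z.val 1).coeff j = _
    rw [act_coeff, HahnSeries.coeff_one]
    split_ifs with h
    · simp [h]
    · simp
  smul_mul z a b := act_mul z.val a b

lemma smul_coeff {n : ℕ} (z : MU n) (a : LL) (j : ℤ) : (z • a).coeff j = (z.val ^ j : ℂˣ) * a.coeff j := rfl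

lemma smul_ne {n : ℕ} (z : MU n) {a : LL} (ha : a ≠ 0) : z • a ≠ 0 := by
  rwa [Ne, smul_eq_zero_iff_eq]

lemma smul_order {n : ℕ} (z : MU n) (a : LL) : (z • a).order = a.order := by
  by_cases ha : a = 0
  · simp [ha]
  apply le_antisymm
  · apply HahnSeries.order_le_of_coeff_ne_zero
    rw [smul_coeff]
    refine mul_ne_zero (Units.ne_zero _) ?_
    rwa [Ne, HahnSeries.coeff_order_eq_zero]
  · apply HahnSeries.order_le_of_coeff_ne_zero
    have : (z • a).coeff (z • a).order ≠ 0 := by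
      rw [Ne, HahnSeries.coeff_order_eq_zero]; exact smul_ne z ha
    rw [smul_coeff] at this
    exact right_ne_zero_of_mul this

lemma smul_vL {n : ℕ} (z : MU n) (a : LL) : vL (z • a) = vL a := by
  by_cases ha : a = 0
  · simp [ha]
  rw [vL_eq ha, vL_eq (smul_ne z ha), smul_order]

lemma smul_algebraMap {n : ℕ} (z : MU n) (c : ℂ) : z • (algebraMap ℂ LL c) = algebraMap ℂ LL c := by
  ext j
  rw [smul_coeff, algMap_eq, HahnSeries.coeff_single]
  split_ifs with h
  · simp [h]
  · simp

lemma hensel (f : ℂ[X]) (hf : 0 < f.natDegree) :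
    ∃ t : LL, aeval t f = HahnSeries.single (-(f.natDegree : ℤ)) 1 ∧ t ≠ 0 ∧ t.order = -1 := by
  classical
  set a := f.natDegree with ha
  have hf0 : f.leadingCoeff ≠ 0 := by
    rw [Ne, leadingCoeff_eq_zero]; rintro rfl; simp at ha; omega
  set c := f.leadingCoeff with hc
  obtain ⟨u, hu⟩ := IsAlgClosed.exists_pow_nat_eq (c⁻¹) hf
  have hu0 : u ≠ 0 := by
    rintro rfl; rw [zero_pow (by omega)] at hu; exact inv_ne_zero hf0 hu.symm
  let F0 : (PowerSeries ℂ)[X] := ∑ i ∈ Finset.range a, Polynomial.C (PowerSeries.C (c⁻¹ * f.coeff i) * PowerSeries.X ^ (a - i)) * X ^ i - Polynomial.C (PowerSeries.C c⁻¹)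
  let F : (PowerSeries ℂ)[X] := X ^ a + F0
  have hF0 : F0.degree < a := by
    refine lt_of_le_of_lt (degree_sub_le _ _) (max_lt ?_ ?_)
    · refine lt_of_le_of_lt (degree_sum_le _ _) ?_
      refine (Finset.sup_lt_iff (WithBot.bot_lt_coe a)).2 ?_
      intro i hi
      exact lt_of_le_of_lt (degree_C_mul_X_pow_le _ _) (WithBot.coe_lt_coe.2 (Finset.mem_range.1 hi))
    · exact lt_of_le_of_lt degree_C_le (by exact_mod_cast hf)
  have hFm : F.Monic := monic_X_pow_add hF0
  have hmap : F.map (PowerSeries.constantCoeff (R := ℂ)) = X ^ a - Polynomial.C c⁻¹ := by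
    simp only [F, F0, Polynomial.map_add, Polynomial.map_sub, Polynomial.map_pow, map_X, Polynomial.map_sum, Polynomial.map_mul, map_C, map_mul, PowerSeries.constantCoeff_C, map_pow, PowerSeries.constantCoeff_X]
    rw [Finset.sum_eq_zero]
    · ring
    · intro i hi
      have h : a - i ≠ 0 := by have := Finset.mem_range.1 hi; omega
      simp [h]
  have hev : ∀ H : (PowerSeries ℂ)[X], PowerSeries.constantCoeff (H.eval (PowerSeries.C u)) = (H.map (PowerSeries.constantCoeff (R := ℂ))).eval u := by
    intro H
    rw [eval_map, ← eval₂_at_apply]; simp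
  have h1 : F.eval (PowerSeries.C u) ∈ Ideal.span {(PowerSeries.X : PowerSeries ℂ)} := by
    rw [Ideal.mem_span_singleton, PowerSeries.X_dvd_iff, hev, hmap]; simp [hu]
  have h2 : IsUnit (Ideal.Quotient.mk (Ideal.span {(PowerSeries.X : PowerSeries ℂ)}) (F.derivative.eval (PowerSeries.C u))) := by
    apply IsUnit.map
    rw [PowerSeries.isUnit_iff_constantCoeff, hev, ← derivative_map, hmap]
    simp only [derivative_sub, derivative_X_pow, derivative_C, sub_zero, eval_mul, eval_pow, eval_X, eval_C, isUnit_iff_ne_zero]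
    refine mul_ne_zero (by exact_mod_cast hf.ne') (pow_ne_zero _ hu0)
  obtain ⟨U, hU, hUu⟩ := HenselianRing.is_henselian F hFm _ h1 h2
  have hUc : PowerSeries.constantCoeff U = u := by
    rw [Ideal.mem_span_singleton, PowerSeries.X_dvd_iff] at hUu
    simpa [sub_eq_zero] using hUu
  set φ := HahnSeries.ofPowerSeries ℤ ℂ with hφ
  have hs : ∀ n : ℕ, (HahnSeries.single (-1 : ℤ) (1:ℂ)) ^ n * (HahnSeries.single (1 : ℤ) (1:ℂ)) ^ n = 1 := by
    intro n; rw [← mul_pow]; simp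
  have hφU : φ U ≠ 0 := by
    intro h0
    have : U = 0 := by
      apply HahnSeries.ofPowerSeries_injective (Γ := ℤ); rw [h0, map_zero]
    rw [this] at hUc; simp at hUc; exact hu0 hUc.symm
  refine ⟨φ U * HahnSeries.single (-1) 1, ?_, ?_, ?_⟩
  · have e1 : φ (F.eval U) = 0 := by rw [hU.eq_zero, map_zero]
    simp only [F, F0, eval_add, eval_sub, eval_pow, eval_X, eval_finsetSum, eval_mul, eval_C, map_add, map_sub, map_pow, map_sum, map_mul] at e1
    rw [aeval_def, eval₂_eq_sum_range, ← ha, Finset.sum_range_succ]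
    have e2 : ∀ x : ℂ, φ (PowerSeries.C x) = algebraMap ℂ LL x := fun x => rfl
    have e3 : φ (PowerSeries.X) = HahnSeries.single 1 1 := HahnSeries.ofPowerSeries_X
    simp only [← map_mul, e2, e3] at e1
    have e4 : algebraMap ℂ LL c * algebraMap ℂ LL c⁻¹ = 1 := by
      rw [← map_mul, mul_inv_cancel₀ hf0, map_one]
    have e5 : (HahnSeries.single (-(a : ℤ)) (1:ℂ)) = (HahnSeries.single (-1 : ℤ) (1:ℂ)) ^ a := by
      rw [HahnSeries.single_pow]; simp
    rw [e5]
    set s' : LL := HahnSeries.single (-1 : ℤ) (1:ℂ)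
    set s : LL := HahnSeries.single (1 : ℤ) (1:ℂ)
    set V := φ U
    have e6 : ∀ i ∈ Finset.range a, algebraMap ℂ LL (f.coeff i) * (V * s') ^ i = s' ^ a * algebraMap ℂ LL c * (algebraMap ℂ LL (c⁻¹ * f.coeff i) * s ^ (a - i) * V ^ i) := by
      intro i hi
      have hi := Finset.mem_range.1 hi
      rw [map_mul, mul_pow]
      have : s' ^ a = s' ^ i * s' ^ (a - i) := by rw [← pow_add]; congr 1; omega
      rw [this]
      linear_combination (-(algebraMap ℂ LL (f.coeff i)) * V ^ i * s' ^ i) * (hs (a - i)) - (algebraMap ℂ LL (f.coeff i)) * V ^ i * s' ^ i * s' ^ (a - i) * s ^ (a - i) * e4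
    rw [Finset.sum_congr rfl e6, ← Finset.mul_sum]
    have e7 : f.coeff a = c := rfl
    rw [e7, mul_pow]
    linear_combination (s' ^ a * algebraMap ℂ LL c) * e1 + s' ^ a * e4
  · exact mul_ne_zero hφU (by simp)
  · rw [HahnSeries.order_mul hφU (by simp), HahnSeries.order_single (by simp)]
    have : (φ U).order = 0 := by
      have h0 : (φ U).coeff ((0 : ℕ) : ℤ) ≠ 0 := by
        rw [hφ, HahnSeries.ofPowerSeries_apply_coeff, PowerSeries.coeff_zero_eq_constantCoeff_apply, hUc]; exact hu0
      have h1 := HahnSeries.order_le_of_coeff_ne_zero h0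
      by_contra h2
      have h3 : (φ U).order < 0 := by omega
      have h4 : (φ U).coeff (φ U).order ≠ 0 := by rwa [Ne, HahnSeries.coeff_order_eq_zero]
      apply h4
      generalize (φ U).order = m at h3
      rw [hφ, HahnSeries.ofPowerSeries_apply]
      apply HahnSeries.embDomain_of_notMem_range
      rintro ⟨j, hj⟩
      simp at hj; omega
    omega

end laurent
end AMS

namespace AMS
open Polynomial

section analytic

lemma vL_pow_iff {a : LL} {m : ℤ} (h : vL a = (2:ℝ) ^ m) : a ≠ 0 ∧ - a.order = m := by
  have ha : a ≠ 0 := by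
    rintro rfl
    rw [map_zero] at h
    have : (0:ℝ) < 2 ^ m := by positivity
    linarith
  refine ⟨ha, ?_⟩
  rw [vL_eq ha] at h
  exact zpow_right_injective₀ (by norm_num) (by norm_num) h

lemma vL_aeval {t : LL} (ht : vL t = 2) {r : ℂ[X]} (hr : r ≠ 0) : vL (aeval t r) = (2:ℝ) ^ (r.natDegree : ℤ) := by
  rw [aeval_def, eval₂_eq_sum_range, Finset.sum_range_succ, add_comm]
  have hc : r.coeff r.natDegree ≠ 0 := by rwa [coeff_natDegree, Ne, leadingCoeff_eq_zero]
  have h1 : vL (algebraMap ℂ LL (r.coeff r.natDegree) * t ^ r.natDegree) = (2:ℝ) ^ (r.natDegree : ℤ) := by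
    rw [map_mul, map_pow, ht, vL_C hc]; simp
  rw [na_eq vL_na, h1]
  rw [h1]
  refine lt_of_le_of_lt (na_sum vL_na (W := (2:ℝ) ^ ((r.natDegree : ℤ) - 1)) _ _ (by positivity) ?_) ?_
  · intro i hi
    have hi := Finset.mem_range.1 hi
    rw [map_mul, map_pow, ht, ← zpow_natCast]
    have h2 : vL (algebraMap ℂ LL (r.coeff i)) ≤ 1 := by
      by_cases h : r.coeff i = 0
      · simp [h]
      · rw [vL_C h]
    have h3 : (2:ℝ) ^ (i:ℤ) ≤ (2:ℝ) ^ ((r.natDegree : ℤ) - 1) := zpow_le_zpow_right₀ (by norm_num) (by omega)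
    have h4 : (0:ℝ) < (2:ℝ) ^ (i:ℤ) := by positivity
    nlinarith
  · exact zpow_lt_zpow_right₀ (by norm_num) (by omega)

lemma prod_two_zpow {G : Type*} (T : Finset G) (δ : G → ℤ) : ∏ x ∈ T, (2:ℝ) ^ (δ x) = (2:ℝ) ^ (∑ x ∈ T, δ x) := by
  classical
  induction T using Finset.induction_on with
  | empty => simp
  | insert x T hx ih => rw [Finset.prod_insert hx, Finset.sum_insert hx, ih, zpow_add₀ (by norm_num)]

lemma arith_end (k l c h : ℤ) (hk' : 2 ≤ k) (hl' : 2 ≤ l) (hc' : 1 ≤ c) (g2 : h ≤ c)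
    (g4 : (l * c - h) * (k * c) ≤ (l * c - 1) * h) : False := by
  have g5 : (l * c - c) * (k * c : ℤ) ≤ (l * c - h) * (k * c : ℤ) := mul_le_mul_of_nonneg_right (by linarith) (by positivity)
  have g6 : (l * c - 1) * h ≤ (l * c - 1 : ℤ) * c := mul_le_mul_of_nonneg_left g2 (by nlinarith)
  have g7 : (c:ℤ) * ((l - 1) * k * c) ≤ c * (l * c - 1) := by linarith
  have g8 := le_of_mul_le_mul_left g7 (by linarith)
  have g9 : (l:ℤ) ≤ (l - 1) * k := by nlinarith
  nlinarith

set_option maxHeartbeats 1000000 in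
theorem analytic (f g : ℂ[X]) (k l c : ℕ) (hk : 2 ≤ k) (hl : 2 ≤ l) (hkl : Nat.Coprime k l) (hc : 0 < c)
    (hf : f.natDegree = l * c) (hg : g.natDegree = k * c) (q : ℂ[X][X]) (hq : q.Monic) (hN : q.natDegree ≤ l * c)
    (hq0 : eval₂ (aeval f : ℂ[X] →ₐ[ℂ] ℂ[X]).toRingHom g q = 0)
    (hker : ∀ r, eval₂ (aeval f : ℂ[X] →ₐ[ℂ] ℂ[X]).toRingHom g r = 0 → q ∣ r)
    (hP : ∃ P, eval₂ (aeval f : ℂ[X] →ₐ[ℂ] ℂ[X]).toRingHom g P = X)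
    (hd : (eval₂ (aeval f : ℂ[X] →ₐ[ℂ] ℂ[X]).toRingHom g (derivative q)).natDegree ≤ l * c - 1) : False := by
  classical
  have hlc : 0 < l * c := by positivity
  have : NeZero (l * c) := ⟨hlc.ne'⟩
  obtain ⟨t, htf, ht0, hto⟩ := hensel f (by omega)
  have htv : vL t = 2 := by rw [vL_eq ht0, hto]; norm_num
  rw [hf] at htf
  set G := MU (l * c)
  set y := aeval t g with hy
  set x := aeval t f with hx
  have hxG : ∀ z : G, z • x = x := by
    intro z
    ext j
    rw [smul_coeff, htf, HahnSeries.coeff_single]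
    split_ifs with h
    · rw [h, zpow_neg, zpow_natCast]
      have : (MU.val z) ^ (l * c) = 1 := (mem_rootsOfUnity _ _).1 z.2
      rw [this]; simp
    · simp
  set ρ : ℂ[X] →+* LL := (aeval x : ℂ[X] →ₐ[ℂ] LL).toRingHom with hρ
  set ev : ℂ[X][X] → ℂ[X] := fun r => eval₂ (aeval f : ℂ[X] →ₐ[ℂ] ℂ[X]).toRingHom g r with hev
  have key0 : ∀ r, (r.map ρ).eval y = aeval t (ev r) := by
    intro r
    rw [eval_map, hy, hev]
    have := hom_eval₂ r (aeval f : ℂ[X] →ₐ[ℂ] ℂ[X]).toRingHom (aeval t : ℂ[X] →ₐ[ℂ] LL).toRingHom g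
    refine Eq.trans ?_ this.symm
    congr 1
    ext i
    · simp [hρ]
    · simp [hρ, hx]
  have key : ∀ r (z : G), (r.map ρ).eval (z • y) = z • aeval t (ev r) := by
    intro r z
    rw [← key0, eval_map, eval_map]
    have := hom_eval₂ r ρ (MulSemiringAction.toRingHom G LL z) y
    refine Eq.trans ?_ this.symm
    have h2 : (MulSemiringAction.toRingHom G LL z).comp ρ = ρ := by
      apply Polynomial.ringHom_ext'
      · apply RingHom.ext; intro i; change z • (aeval x (C i)) = aeval x (C i); rw [aeval_C]; exact smul_algebraMap z i
      · change z • (aeval x (X : ℂ[X])) = (aeval x (X : ℂ[X])); rw [aeval_X]; exact hxG z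
    rw [h2]; rfl
  have htinj : ∀ z w : G, z • t = w • t → z = w := by
    intro z w h
    have : (z • t).coeff (-1) = (w • t).coeff (-1) := by rw [h]
    rw [smul_coeff, smul_coeff] at this
    have h1 : t.coeff (-1) ≠ 0 := by rw [← hto, Ne, HahnSeries.coeff_order_eq_zero]; exact ht0
    have h2 := Units.ext (mul_right_cancel₀ h1 this)
    rw [zpow_neg_one, zpow_neg_one, inv_inj] at h2
    exact Subtype.ext h2
  obtain ⟨P, hP⟩ := hP
  have hinj : Function.Injective (fun z : G => z • y) := by
    intro z w h
    apply htinj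
    have h1 := key P z
    have h2 := key P w
    have hP' : ev P = X := hP
    rw [hP', aeval_X] at h1 h2
    rw [← h1, ← h2]
    exact congrArg (fun w => eval w (P.map ρ)) h
  have hprod : ∏ z : G, (X - C (z • y)) = q.map ρ := by
    refine (Polynomial.eq_of_monic_of_dvd_of_natDegree_le ?_ ?_ ?_ ?_).symm
    · exact monic_prod_of_monic _ _ fun z _ => monic_X_sub_C _
    · exact hq.map _
    · refine Finset.prod_dvd_of_coprime (s := fun z : G => X - C (z • y)) ?_ ?_
      · intro z _ w _ hzw
        exact pairwise_coprime_X_sub_C hinj hzw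
      · intro z _
        rw [dvd_iff_isRoot, IsRoot, key]
        have : ev q = 0 := hq0
        rw [this]; simp
    · rw [natDegree_prod_of_monic _ _ fun z _ => monic_X_sub_C _]
      simp only [natDegree_X_sub_C, Finset.sum_const, Finset.card_univ, card_MU, G, smul_eq_mul, mul_one]
      rwa [hq.natDegree_map]
  have hNeq : q.natDegree = l * c := by
    rw [← hq.natDegree_map ρ, ← hprod, natDegree_prod_of_monic _ _ fun z _ => monic_X_sub_C _]
    simp only [natDegree_X_sub_C, Finset.sum_const, Finset.card_univ, card_MU, G, smul_eq_mul, mul_one]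
  have happ : ∀ d e, d*e = Fintype.card G → 1<d → ∃ p : LL[X], IsMonicOfDegree p e ∧ (∏ g : G, (X - C (g•y)) - p^d).degree < (((d-1)*e:ℕ):WithBot ℕ) ∧ ∀ g : G, 1 ≤ vL (p.eval (g•y)) := by
    intro d e hde hd1
    rw [card_MU] at hde
    obtain ⟨p, hpm, hpd, -, hpdeg⟩ := approx_root (B := fun _ => (⊤ : Submodule ℚ ℂ[X])) (fun _ _ _ _ _ _ => trivial) trivial d e (by omega) q hq (by rw [hNeq, hde])
      ⟨fun _ _ _ => trivial, fun j hj => coeff_eq_zero_of_natDegree_lt (by rw [hNeq, ← hde]; exact hj)⟩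
    refine ⟨p.map ρ, ⟨by rw [hpm.natDegree_map, hpd], hpm.map _⟩, ?_, ?_⟩
    · rw [hprod, ← Polynomial.map_pow, ← Polynomial.map_sub]
      exact lt_of_le_of_lt degree_map_le hpdeg
    · intro z
      rw [key, smul_vL, vL_aeval htv]
      · exact one_le_zpow₀ (by norm_num) (by positivity)
      · intro h0
        have := natDegree_le_of_dvd (hker p h0) hpm.ne_zero
        rw [hNeq, hpd, ← hde] at this
        have he : 0 < e := by
          rcases Nat.eq_zero_or_pos e with h | h
          · rw [h] at hde; omega
          · exact h
        nlinarith
  have hne : ∀ z : G, z ≠ 1 → z • y ≠ y := by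
    intro z hz h
    apply hz; apply hinj; simp only [one_smul]; exact h
  have hstep := fun (z : G) (hz : z ≠ 1) => group_step vL_na vL_rat (fun (g : G) a => smul_vL g a) y happ z (hne z hz)
  set δ : G → ℤ := fun z => - (y - z • y).order with hδ
  have hvδ : ∀ z : G, z ≠ 1 → vL (y - z • y) = (2:ℝ) ^ (δ z) := fun z hz => vL_eq (sub_ne_zero.2 (hne z hz).symm)
  set T : Finset G := Finset.univ.erase 1 with hT
  have hv1 : vL (y - (1:G) • y) = 0 := by simp
  have hlt : ∀ z w : G, z ≠ 1 → w ≠ 1 → (vL (y - z • y) < vL (y - w • y) ↔ δ z < δ w) := by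
    intro z w hz hw
    rw [hvδ z hz, hvδ w hw]; exact zpow_lt_zpow_iff_right₀ (by norm_num)
  have hhyp : ∀ z ∈ T, 0 ≤ ∑ x ∈ T with δ z < δ x, δ x + (1 + ((T.filter fun x => δ x ≤ δ z).card : ℤ)) * δ z := by
    intro z hz
    have hz1 : z ≠ 1 := (Finset.mem_erase.1 hz).1
    have h := hstep z hz1
    have hpos : 0 < vL (y - z • y) := by rw [hvδ z hz1]; positivity
    have s1 : (Finset.univ.filter fun g : G => vL (y - z • y) < vL (y - g • y)) = T.filter fun g => δ z < δ g := by
      ext w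
      simp only [Finset.mem_filter, Finset.mem_univ, true_and, hT, Finset.mem_erase, and_true]
      by_cases hw : w = 1
      · simp only [hw, hv1, ne_eq, not_true, false_and, iff_false]; linarith
      · simp only [hw, ne_eq, not_false_eq_true, true_and]; exact hlt z w hz1 hw
    have s2 : (Finset.univ.filter fun g : G => vL (y - g • y) ≤ vL (y - z • y)) = insert 1 (T.filter fun g => δ g ≤ δ z) := by
      ext w
      simp only [Finset.mem_filter, Finset.mem_univ, true_and, hT, Finset.mem_erase, and_true, Finset.mem_insert]
      by_cases hw : w = 1
      · simp only [hw, hv1, true_or, iff_true]; linarith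
      · simp only [hw, ne_eq, not_false_eq_true, true_and, false_or]
        rw [← not_lt, ← not_lt, hlt z w hz1 hw]
    rw [s1, s2, Finset.card_insert_of_notMem (by simp [hT]), Finset.prod_congr rfl (g := fun w => (2:ℝ) ^ (δ w)), hvδ z hz1, ← zpow_natCast, ← zpow_mul] at h
    · rw [prod_two_zpow, ← zpow_add₀ (by norm_num), one_le_zpow_iff_right₀ (by norm_num)] at h
      push_cast at h
      linarith
    · intro w hw
      exact hvδ w (Finset.mem_erase.1 (Finset.mem_filter.1 hw).1).1
  -- the discriminant sum
  have hTne : ∀ z ∈ T, z ≠ 1 := fun z hz => (Finset.mem_erase.1 hz).1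
  have hS : ∑ z ∈ T, δ z ≤ (l * c : ℤ) - 1 := by
    have h1 : (derivative (q.map ρ)).eval y = ∏ z ∈ T, (y - z • y) := by
      rw [← hprod, ← Finset.mul_prod_erase Finset.univ _ (Finset.mem_univ (1:G)), derivative_mul, eval_add, eval_mul, eval_mul]
      simp [eval_prod, hT]
    have h2 : vL (∏ z ∈ T, (y - z • y)) = (2:ℝ) ^ (∑ z ∈ T, δ z) := by
      rw [map_prod, ← prod_two_zpow]
      exact Finset.prod_congr rfl fun z hz => hvδ z (hTne z hz)
    rw [← h1, derivative_map, key0] at h2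
    have h3 : ev (derivative q) ≠ 0 := by
      intro h; rw [h, map_zero, map_zero] at h2
      have : (0:ℝ) < (2:ℝ) ^ (∑ z ∈ T, δ z) := by positivity
      linarith
    rw [vL_aeval htv h3] at h2
    have h4 := zpow_right_injective₀ (by norm_num) (by norm_num) h2
    have h5 : (ev (derivative q)).natDegree ≤ l * c - 1 := hd
    rw [← h4]
    zify [show 1 ≤ l * c from hlc] at h5
    exact h5
  -- the top level
  have hg0 : g ≠ 0 := by
    rintro rfl; simp at hg; omega
  obtain ⟨hy0, hyo⟩ := vL_pow_iff (vL_aeval htv hg0)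
  rw [← hy] at hy0 hyo
  set B : ℤ := k * c with hB
  have hyo' : y.order = - B := by rw [hg] at hyo; push_cast at hyo; linarith
  have hcB : y.coeff (-B) ≠ 0 := by rw [← hyo', Ne, HahnSeries.coeff_order_eq_zero]; exact hy0
  have hδB : ∀ z ∈ T, δ z ≤ B := by
    intro z hz
    have h1 : vL (y - z • y) ≤ (2:ℝ) ^ B := by
      have h2 := vL_na y (-(z • y))
      have h3 : vL y = (2:ℝ) ^ B := by rw [vL_eq hy0, hyo', neg_neg]
      rw [← sub_eq_add_neg, AbsoluteValue.map_neg, smul_vL, max_self, h3] at h2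
      exact h2
    rw [hvδ z (hTne z hz)] at h1
    exact (zpow_le_zpow_iff_right₀ (by norm_num)).1 h1
  have hδc : ∀ z ∈ T, δ z ≤ B - 1 → (MU.val z : ℂ) ^ c = 1 := by
    intro z hz h
    have h1 : (y - z • y).coeff (-B) = 0 := HahnSeries.coeff_eq_zero_of_lt_order (by simp only [hδ] at h; omega)
    rw [HahnSeries.coeff_sub, smul_coeff] at h1
    have h2 : (1 - ((MU.val z ^ (-B) : ℂˣ) : ℂ)) * y.coeff (-B) = 0 := by linear_combination h1
    have h3 : ((MU.val z ^ (-B) : ℂˣ) : ℂ) = 1 := by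
      rcases mul_eq_zero.1 h2 with h | h
      · linear_combination -h
      · exact absurd h hcB
    have h4 : (MU.val z) ^ (k * c) = 1 := by
      have : (MU.val z) ^ (-B) = 1 := Units.ext h3
      rw [zpow_neg, inv_eq_one] at this
      have h5 : B = ((k * c : ℕ) : ℤ) := by simp [hB]
      rwa [h5, zpow_natCast] at this
    have h5 : (MU.val z) ^ (l * c) = 1 := (mem_rootsOfUnity _ _).1 z.2
    have h6 := pow_gcd_eq_one.2 ⟨h4, h5⟩
    rw [Nat.gcd_mul_right, hkl, one_mul] at h6
    rw [← Units.val_pow_eq_pow_val, h6]; rfl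
  set E := T.filter fun z => δ z ≤ B - 1 with hE
  have hEc : 1 + E.card ≤ c := by
    have h1 : (1:G) ∉ E := by simp [hE, hT]
    rw [add_comm, ← Finset.card_insert_of_notMem h1]
    calc (insert 1 E).card ≤ (nthRoots c (1:ℂ)).toFinset.card := by
          apply Finset.card_le_card_of_injOn (fun z => (MU.val z : ℂ))
          · intro z hz
            simp only [Finset.mem_coe, Multiset.mem_toFinset, mem_nthRoots hc]
            rcases Finset.mem_insert.1 hz with h | h
            · rw [h]; simp
            · exact hδc z (Finset.mem_filter.1 h).1 (Finset.mem_filter.1 h).2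
          · intro z _ w _ h
            exact Subtype.ext (Units.ext h)
      _ ≤ _ := (Multiset.toFinset_card_le _).trans (card_nthRoots _ _)
  have hTc : (T.card : ℤ) + 1 = l * c := by
    have : T.card + 1 = l * c := by
      rw [hT, Finset.card_erase_add_one (Finset.mem_univ _), Finset.card_univ, card_MU]
    exact_mod_cast this
  obtain ⟨m, hm⟩ : ∃ m : ℕ, ∀ z ∈ T, B - 1 - m < δ z := by
    refine ⟨∑ z ∈ T, (B - δ z).toNat, fun z hz => ?_⟩
    have : (B - δ z).toNat ≤ ∑ z ∈ T, (B - δ z).toNat := Finset.single_le_sum (f := fun z => (B - δ z).toNat) (fun _ _ => Nat.zero_le _) hz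
    have h2 := Int.self_le_toNat (B - δ z)
    omega
  have htele := tele T δ hhyp (B - 1) m
  have f1 : (T.filter fun x => δ x ≤ B - 1 - m) = ∅ := by
    rw [Finset.filter_eq_empty_iff]; intro z hz; have := hm z hz; omega
  have f2 : (T.filter fun x => B - 1 - m < δ x) = T := Finset.filter_true_of_mem hm
  have f3 : ∑ z ∈ T with B - 1 < δ z, δ z = (T.filter fun z => B - 1 < δ z).card * B := by
    rw [Finset.sum_congr rfl (g := fun _ => B)]
    · simp
    · intro z hz
      have := hδB z (Finset.mem_filter.1 hz).1
      have := (Finset.mem_filter.1 hz).2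
      omega
  have f4 : ((T.filter fun z => B - 1 < δ z).card : ℤ) + E.card = T.card := by
    have := Finset.card_filter_add_card_filter_not (s := T) (fun z => δ z ≤ B - 1)
    simp only [not_le] at this
    rw [← hE] at this
    omega
  rw [f1, f2, f3, ← hE] at htele
  simp only [Finset.card_empty, Nat.cast_zero, add_zero, mul_one] at htele
  set h : ℤ := 1 + (E.card : ℤ) with hh
  have g1 : ((T.filter fun z => B - 1 < δ z).card : ℤ) = l * c - h := by linarith
  rw [g1] at htele
  have g2 : h ≤ c := by rw [hh]; exact_mod_cast hEc
  have g3 : 1 ≤ h := by omega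
  have g4 : (l * c - h) * (k * c : ℤ) ≤ (l * c - 1) * h := htele.trans (mul_le_mul_of_nonneg_right hS (by omega))
  exact arith_end k l c h (by exact_mod_cast hk) (by exact_mod_cast hl) (by exact_mod_cast hc) g2 g4

end analytic
end AMS

namespace AMS
open Polynomial

section alg

lemma deg_le (f g : ℂ[X]) (hf : 0 < f.natDegree) (q : ℂ[X][X])
    (hker : ∀ r, eval₂ (aeval f : ℂ[X] →ₐ[ℂ] ℂ[X]).toRingHom g r = 0 → q ∣ r) : q.natDegree ≤ f.natDegree := by
  have hf0 : f.leadingCoeff ≠ 0 := by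
    rw [Ne, leadingCoeff_eq_zero]; rintro rfl; simp at hf
  set c := f.leadingCoeff with hc
  set F : ℂ[X] →+* ℂ[X] := (aeval f : ℂ[X] →ₐ[ℂ] ℂ[X]).toRingHom with hF
  have hFC : F.comp C = C := by
    apply RingHom.ext; intro i; simp [hF]
  have hFX : F X = f := by simp [hF]
  set m : ℂ[X][X] := C (C c⁻¹) * (f.map C - C X) with hm
  have hdm : (f.map (C : ℂ →+* ℂ[X])).degree = f.natDegree := by
    rw [degree_map, degree_eq_natDegree]; rintro rfl; simp at hf
  have hlt : (C (X : ℂ[X]) : ℂ[X][X]).degree < (f.map (C : ℂ →+* ℂ[X])).degree := by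
    rw [hdm]; exact lt_of_le_of_lt degree_C_le (by exact_mod_cast hf)
  have hmd : (f.map C - C X : ℂ[X][X]).natDegree = f.natDegree := by
    rw [natDegree_eq_of_degree_eq_some]; rw [degree_sub_eq_left_of_degree_lt hlt, hdm]
  have hml : (f.map C - C X : ℂ[X][X]).leadingCoeff = C c := by
    rw [leadingCoeff_sub_of_degree_lt hlt, leadingCoeff_map]
  have hmm : m.Monic := by
    rw [Monic, hm, leadingCoeff_mul, hml, leadingCoeff_C, ← C_mul, inv_mul_cancel₀ hf0, C_1]
  have hmn : m.natDegree = f.natDegree := by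
    rw [hm, natDegree_C_mul (by simpa using hf0), hmd]
  have : Module.Finite ℂ[X] (AdjoinRoot m) := (AdjoinRoot.powerBasis' hmm).finite
  have : Module.Free ℂ[X] (AdjoinRoot m) := Module.Free.of_basis (AdjoinRoot.powerBasis' hmm).basis
  set γ : AdjoinRoot m := AdjoinRoot.mk m (g.map C) with hγ
  set r := (Algebra.lmul ℂ[X] (AdjoinRoot m) γ).charpoly with hr
  have hr0 : aeval γ r = 0 := by
    have h1 := LinearMap.aeval_self_charpoly (Algebra.lmul ℂ[X] (AdjoinRoot m) γ)
    rw [← hr, aeval_algHom_apply] at h1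
    have := congrArg (fun e : Module.End ℂ[X] (AdjoinRoot m) => e 1) h1
    simpa using this
  have hrn : r.natDegree = f.natDegree := by
    rw [hr, LinearMap.charpoly_natDegree, (AdjoinRoot.powerBasis' hmm).finrank, AdjoinRoot.powerBasis'_dim, hmn]
  have hl : eval₂ F X m = 0 := by
    rw [hm, eval₂_mul, eval₂_sub, eval₂_map, hFC, eval₂_C, eval₂_C, hFX, eval₂_C_X, sub_self, mul_zero]
  set Λ := AdjoinRoot.lift F X hl with hΛ
  have h2 : Λ (aeval γ r) = eval₂ F g r := by
    rw [aeval_def, hom_eval₂]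
    congr 1
    · apply RingHom.ext; intro i
      change Λ (AdjoinRoot.of m i) = _
      rw [hΛ, AdjoinRoot.lift_of]
    · rw [hγ, hΛ, AdjoinRoot.lift_mk, eval₂_map, hFC, eval₂_C_X]
  rw [hr0, map_zero] at h2
  have := natDegree_le_of_dvd (hker r h2.symm) (LinearMap.charpoly_monic _).ne_zero
  rwa [hrn] at this

open MvPolynomial in
lemma chain (f g : ℂ[X]) (p : MvPolynomial (Fin 2) ℂ) :
    derivative (MvPolynomial.aeval ![f, g] p) = MvPolynomial.aeval ![f, g] (pderiv 0 p) * derivative f + MvPolynomial.aeval ![f, g] (pderiv 1 p) * derivative g := by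
  induction p using MvPolynomial.induction_on with
  | C a => simp
  | add p q hp hq => simp only [map_add, hp, hq]; ring
  | mul_X p i hp =>
    simp only [map_mul, derivative_mul, hp, Derivation.leibniz, smul_eq_mul, map_add, MvPolynomial.aeval_X]
    fin_cases i <;> simp [pderiv_X] <;> ring

open MvPolynomial in
lemma dvd_der (f g : ℂ[X]) (q : MvPolynomial (Fin 2) ℂ) (hq0 : MvPolynomial.aeval ![f, g] q = 0)
    (hker : ∀ r, MvPolynomial.aeval ![f, g] r = 0 → q ∣ r) (P : MvPolynomial (Fin 2) ℂ)
    (hP : MvPolynomial.aeval ![f, g] P = (Polynomial.X : ℂ[X])) :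
    MvPolynomial.aeval ![f, g] (pderiv 1 q) ∣ derivative f := by
  set φ : MvPolynomial (Fin 2) ℂ →ₐ[ℂ] ℂ[X] := MvPolynomial.aeval ![f, g] with hφ
  have hcomp : ∀ h : ℂ[X], φ (Polynomial.aeval P h) = h := by
    intro h
    rw [← Polynomial.aeval_algHom_apply, hP, Polynomial.aeval_X_left_apply]
  have h0 : φ (MvPolynomial.X 0) = f := by simp [hφ]
  have h1 : φ (MvPolynomial.X 1) = g := by simp [hφ]
  obtain ⟨r1, hr1⟩ := hker (Polynomial.aeval P f - MvPolynomial.X 0) (by rw [map_sub, hcomp, h0, sub_self])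
  obtain ⟨r2, hr2⟩ := hker (Polynomial.aeval P g - MvPolynomial.X 1) (by rw [map_sub, hcomp, h1, sub_self])
  have key : ∀ (h : ℂ[X]) (i : Fin 2), φ (pderiv i (Polynomial.aeval P h)) = derivative h * φ (pderiv i P) := by
    intro h i
    rw [Derivation.map_aeval, smul_eq_mul, map_mul, hcomp]
  have e : ∀ (i : Fin 2) (r : MvPolynomial (Fin 2) ℂ), φ (pderiv i (q * r)) = φ (pderiv i q) * φ r := by
    intro i r
    rw [Derivation.leibniz, map_add, smul_eq_mul, smul_eq_mul, map_mul, map_mul, hq0]; ring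
  have a1 := congrArg (fun p => φ (pderiv 0 p)) hr1
  have a2 := congrArg (fun p => φ (pderiv 1 p)) hr1
  have a3 := congrArg (fun p => φ (pderiv 0 p)) hr2
  have a4 := congrArg (fun p => φ (pderiv 1 p)) hr2
  simp only [map_sub, key, e] at a1 a2 a3 a4
  simp [pderiv_X] at a1 a2 a3 a4
  have a5 := chain f g q
  rw [← hφ, hq0, derivative_zero] at a5
  have a6 := chain f g P
  rw [← hφ, hP, derivative_X] at a6
  refine ⟨derivative g * φ r1 - derivative f * φ r2, ?_⟩
  linear_combination (φ r1) * a5 - derivative f * a6 - derivative f * a1 - derivative f * a4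

lemma dom (f g : ℂ[X]) (q : MvPolynomial (Fin 2) ℂ) (s₀ : Fin 2 →₀ ℕ) (hs : s₀ ∈ q.support)
    (hne : f ^ s₀ 0 * g ^ s₀ 1 ≠ 0)
    (h : ∀ s ∈ q.support, s ≠ s₀ → s 0 * f.natDegree + s 1 * g.natDegree < s₀ 0 * f.natDegree + s₀ 1 * g.natDegree) :
    MvPolynomial.aeval ![f, g] q ≠ 0 := by
  intro h0
  have h1 := congrArg (fun p => Polynomial.coeff p (s₀ 0 * f.natDegree + s₀ 1 * g.natDegree)) h0
  simp only [MvPolynomial.aeval_def, MvPolynomial.eval₂_eq', finsetSum_coeff, Fin.prod_univ_two, Matrix.cons_val_zero, Matrix.cons_val_one, algebraMap_eq, coeff_C_mul, coeff_zero] at h1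
  rw [Finset.sum_eq_single_of_mem s₀ hs] at h1
  · have hn : (f ^ s₀ 0 * g ^ s₀ 1).natDegree = s₀ 0 * f.natDegree + s₀ 1 * g.natDegree := by
      rw [natDegree_mul (left_ne_zero_of_mul hne) (right_ne_zero_of_mul hne), natDegree_pow, natDegree_pow]
    rw [← hn, coeff_natDegree] at h1
    exact mul_ne_zero (MvPolynomial.mem_support_iff.1 hs) (leadingCoeff_ne_zero.2 hne) h1
  · intro s hs' hss
    rw [coeff_eq_zero_of_natDegree_lt, mul_zero]
    refine lt_of_le_of_lt ?_ (h s hs' hss)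
    exact natDegree_mul_le.trans (add_le_add natDegree_pow_le natDegree_pow_le)

lemma psi_monic (q : MvPolynomial (Fin 2) ℂ) (k l n : ℕ) (hk : 2 ≤ k) (hl : 2 ≤ l)
    (hw : ∀ s ∈ q.support, l * s 0 + k * s 1 ≤ k * l * n)
    (h2 : q.coeff (Finsupp.single 1 (l * n)) = 1) :
    (MvPolynomial.aeval ![C X, X] q : ℂ[X][X]).Monic := by
  have hs1 : ∀ s ∈ q.support, s 1 ≤ l * n := by
    intro s hs
    have := hw s hs
    have h3 : k * s 1 ≤ k * (l * n) := by nlinarith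
    exact Nat.le_of_mul_le_mul_left h3 (by omega)
  have hexp : (MvPolynomial.aeval ![C X, X] q : ℂ[X][X]) = ∑ s ∈ q.support, C (C (q.coeff s) * X ^ (s 0)) * X ^ (s 1) := by
    rw [MvPolynomial.aeval_def, MvPolynomial.eval₂_eq']
    refine Finset.sum_congr rfl fun s _ => ?_
    simp only [Fin.prod_univ_two, Matrix.cons_val_zero, Matrix.cons_val_one, C_mul, C_pow]
    rw [mul_assoc]; rfl
  rw [hexp]
  refine monic_of_natDegree_le_of_coeff_eq_one (l * n) ?_ ?_
  · refine natDegree_sum_le_of_forall_le _ _ fun s hs => ?_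
    exact (natDegree_C_mul_X_pow_le _ _).trans (hs1 s hs)
  · have hmem : (Finsupp.single 1 (l * n) : Fin 2 →₀ ℕ) ∈ q.support := by
      rw [MvPolynomial.mem_support_iff, h2]; exact one_ne_zero
    rw [finsetSum_coeff, Finset.sum_eq_single_of_mem _ hmem]
    · rw [h2, coeff_C_mul_X_pow]; simp
    · intro s hs hne
      rw [coeff_C_mul_X_pow, if_neg]
      intro h
      apply hne
      have := hw s hs
      have h3 : s 0 = 0 := by
        rw [← h] at this
        have : l * s 0 ≤ 0 := by nlinarith
        rcases Nat.eq_zero_or_pos (s 0) with h | h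
        · exact h
        · nlinarith
      ext i
      fin_cases i
      · simp [h3]
      · simp [h]

set_option maxHeartbeats 600000 in
theorem main_alg (q : MvPolynomial (Fin 2) ℂ)
    (h : Nonempty ((MvPolynomial (Fin 2) ℂ ⧸ Ideal.span {q}) ≃ₐ[ℂ] ℂ[X])) (k l n : ℕ) (hk : 2 ≤ k) (hl : 2 ≤ l)
    (hkl : Nat.Coprime k l) (hn : 0 < n)
    (hw : ∀ s ∈ q.support, l * s 0 + k * s 1 ≤ k * l * n)
    (h1 : q.coeff (Finsupp.single 0 (k * n)) = 1) (h2 : q.coeff (Finsupp.single 1 (l * n)) = 1) : False := by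
  obtain ⟨e⟩ := h
  set φ : MvPolynomial (Fin 2) ℂ →ₐ[ℂ] ℂ[X] := e.toAlgHom.comp (Ideal.Quotient.mkₐ ℂ (Ideal.span {q})) with hφ
  set f := φ (MvPolynomial.X 0) with hf
  set g := φ (MvPolynomial.X 1) with hg
  have hφa : φ = MvPolynomial.aeval ![f, g] := by
    apply MvPolynomial.algHom_ext
    intro i; fin_cases i <;> simp [hf, hg]
  have hsurj : Function.Surjective φ := e.surjective.comp (Ideal.Quotient.mkₐ_surjective ℂ (Ideal.span {q}))
  have hker : ∀ r, φ r = 0 ↔ q ∣ r := by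
    intro r
    rw [← Ideal.mem_span_singleton, ← Ideal.Quotient.eq_zero_iff_mem]
    exact e.map_eq_zero_iff
  have hq0 : φ q = 0 := (hker q).2 dvd_rfl
  obtain ⟨P, hP⟩ := hsurj X
  have hm1 : (Finsupp.single 0 (k * n) : Fin 2 →₀ ℕ) ∈ q.support := by
    rw [MvPolynomial.mem_support_iff, h1]; exact one_ne_zero
  have hm2 : (Finsupp.single 1 (l * n) : Fin 2 →₀ ℕ) ∈ q.support := by
    rw [MvPolynomial.mem_support_iff, h2]; exact one_ne_zero
  have hdeg : k * f.natDegree = l * g.natDegree := by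
    rcases lt_trichotomy (k * f.natDegree) (l * g.natDegree) with hlt | heq | hlt
    · exfalso
      refine dom f g q _ hm2 ?_ ?_ (by rw [← hφa]; exact hq0)
      · have : g ≠ 0 := by intro h; rw [h] at hlt; simp at hlt
        simpa using fun h => absurd h this
      · intro s hs hne
        simp only [Finsupp.single_apply]
        simp
        have := hw s hs
        by_cases hs0 : s 0 = 0
        · have : s 1 < l * n := by
            refine lt_of_le_of_ne ?_ ?_
            · rw [hs0] at this; exact le_of_mul_le_mul_left (a := k) (by linarith) (by omega)
            · intro h; apply hne; ext i; fin_cases i <;> simp [hs0, h]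
          rw [hs0]
          have hg : 0 < g.natDegree := by
            rcases Nat.eq_zero_or_pos g.natDegree with h | h
            · rw [h] at hlt; omega
            · exact h
          nlinarith
        · have h3 : 0 < s 0 := Nat.pos_of_ne_zero hs0
          have h4 : s 0 * (k * f.natDegree) < s 0 * (l * g.natDegree) := Nat.mul_lt_mul_of_pos_left hlt h3
          have h5 : (l * s 0 + k * s 1) * g.natDegree ≤ (k * l * n) * g.natDegree := Nat.mul_le_mul_right _ this
          refine Nat.lt_of_mul_lt_mul_left (a := k) ?_
          linarith
    · exact heq
    · exfalso
      refine dom f g q _ hm1 ?_ ?_ (by rw [← hφa]; exact hq0)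
      · have : f ≠ 0 := by intro h; rw [h] at hlt; simp at hlt
        simpa using fun h => absurd h this
      · intro s hs hne
        simp only [Finsupp.single_apply]
        simp
        have := hw s hs
        by_cases hs0 : s 1 = 0
        · have : s 0 < k * n := by
            refine lt_of_le_of_ne ?_ ?_
            · rw [hs0] at this; exact le_of_mul_le_mul_left (a := l) (by linarith) (by omega)
            · intro h; apply hne; ext i; fin_cases i <;> simp [hs0, h]
          rw [hs0]
          have hg : 0 < f.natDegree := by
            rcases Nat.eq_zero_or_pos f.natDegree with h | h
            · rw [h] at hlt; omega
            · exact h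
          nlinarith
        · have h3 : 0 < s 1 := Nat.pos_of_ne_zero hs0
          have h4 : s 1 * (l * g.natDegree) < s 1 * (k * f.natDegree) := Nat.mul_lt_mul_of_pos_left hlt h3
          have h5 : (l * s 0 + k * s 1) * f.natDegree ≤ (k * l * n) * f.natDegree := Nat.mul_le_mul_right _ this
          refine Nat.lt_of_mul_lt_mul_left (a := l) ?_
          linarith
  obtain ⟨c, hc⟩ : l ∣ f.natDegree := (Nat.Coprime.dvd_mul_left (hkl.symm)).1 ⟨_, hdeg⟩
  have hcg : g.natDegree = k * c := by
    rw [hc] at hdeg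
    exact Nat.eq_of_mul_eq_mul_left (show 0 < l by omega) (by linarith)
  have hc0 : 0 < c := by
    rcases Nat.eq_zero_or_pos c with h | h
    · exfalso
      rw [h, mul_zero] at hc hcg
      have e1 := eq_C_of_natDegree_eq_zero hc
      have e2 := eq_C_of_natDegree_eq_zero hcg
      have e3 : φ = (Algebra.ofId ℂ ℂ[X]).comp (MvPolynomial.aeval ![f.coeff 0, g.coeff 0]) := by
        apply MvPolynomial.algHom_ext
        intro i
        fin_cases i
        · change f = _; rw [e1]; simp [Algebra.ofId_apply]
        · change g = _; rw [e2]; simp [Algebra.ofId_apply]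
      rw [e3] at hP
      have := congrArg natDegree hP
      simp [Algebra.ofId_apply] at this
    · exact h
  set F : ℂ[X] →+* ℂ[X] := (aeval f : ℂ[X] →ₐ[ℂ] ℂ[X]).toRingHom with hF
  set ψ : MvPolynomial (Fin 2) ℂ →ₐ[ℂ] ℂ[X][X] := MvPolynomial.aeval ![C X, X] with hψ
  have hev : ∀ r, eval₂ F g (ψ r) = φ r := by
    intro r
    have : ((eval₂RingHom F g).comp ψ.toRingHom) = φ.toRingHom := by
      apply MvPolynomial.ringHom_ext
      · intro c
        have : ψ (MvPolynomial.C c) = C (C c) := MvPolynomial.aeval_C _ _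
        have h' : φ (MvPolynomial.C c) = C c := by rw [hφa]; exact MvPolynomial.aeval_C _ _
        change eval₂ F g (ψ (MvPolynomial.C c)) = φ (MvPolynomial.C c)
        rw [this, h', eval₂_C, hF]; simp
      · intro i
        fin_cases i
        · change eval₂ F g (ψ (MvPolynomial.X 0)) = f
          rw [hψ, MvPolynomial.aeval_X]; simp [hF]
        · change eval₂ F g (ψ (MvPolynomial.X 1)) = g
          rw [hψ, MvPolynomial.aeval_X]; simp
    exact congrArg (fun j : MvPolynomial (Fin 2) ℂ →+* ℂ[X] => j r) this
  have hψs : Function.Surjective ψ := by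
    intro r
    induction r using Polynomial.induction_on' with
    | add p q hp hq =>
      obtain ⟨a, rfl⟩ := hp
      obtain ⟨b, rfl⟩ := hq
      exact ⟨a + b, map_add _ _ _⟩
    | monomial m p =>
      refine ⟨(Polynomial.aeval (MvPolynomial.X 0) p) * MvPolynomial.X 1 ^ m, ?_⟩
      rw [map_mul, map_pow, ← Polynomial.aeval_algHom_apply, hψ, MvPolynomial.aeval_X, MvPolynomial.aeval_X, ← C_mul_X_pow_eq_monomial]
      congr 1
      simp only [Matrix.cons_val_zero]
      have : (Polynomial.aeval (C X : ℂ[X][X]) p) = C (Polynomial.aeval (X : ℂ[X]) p) := by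
        have := Polynomial.aeval_algHom_apply (CAlgHom (R := ℂ) (A := ℂ[X])) X p
        exact this
      rw [this, aeval_X_left_apply]
  have hker' : ∀ r, eval₂ F g r = 0 → ψ q ∣ r := by
    intro r hr
    obtain ⟨r, rfl⟩ := hψs r
    rw [hev, hker] at hr
    obtain ⟨w, hw'⟩ := hr
    exact ⟨ψ w, by rw [hw', map_mul]⟩
  have hfpos : 0 < f.natDegree := by rw [hc]; positivity
  have hder : ∀ r, derivative (ψ r) = ψ (MvPolynomial.pderiv 1 r) := by
    intro r
    induction r using MvPolynomial.induction_on with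
    | C a =>
      have : ψ (MvPolynomial.C a) = C (C a) := MvPolynomial.aeval_C _ _
      rw [this]; simp
    | add p q hp hq => simp only [map_add, hp, hq]
    | mul_X p i hp =>
      simp only [map_mul, derivative_mul, hp, Derivation.leibniz, smul_eq_mul, map_add]
      fin_cases i <;> simp [hψ, MvPolynomial.pderiv_X] <;> ring
  refine analytic f g k l c hk hl hkl hc0 hc hcg (ψ q) (psi_monic q k l n hk hl hw h2) ?_ ?_ hker' ⟨ψ P, by rw [← hF, hev, hP]⟩ ?_
  · rw [← hc]; exact deg_le f g hfpos _ hker'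
  · rw [← hF, hev, hq0]
  · rw [← hF, hder, hev, ← hc]
    have hdv : φ (MvPolynomial.pderiv 1 q) ∣ derivative f := by
      rw [hφa] at hq0 hP ⊢
      exact dvd_der f g q hq0 (fun r hr => (hker r).1 (by rw [hφa]; exact hr)) P hP
    have hf' : derivative f ≠ 0 := by
      intro h
      have := derivative_eq_zero.1 h
      omega
    exact (natDegree_le_of_dvd hdv hf').trans (natDegree_derivative_le _)

end alg
end AMS


namespace AMS
open MvPolynomial

lemma coeff_leadingPart (k l : ℕ) (q : MvPolynomial (Fin 2) ℂ) (s : Fin 2 →₀ ℕ) (h : coeff s (leadingPart k l q) = 1) :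
    coeff s q = 1 ∧ l * s 0 + k * s 1 = wdeg k l q := by
  classical
  rw [leadingPart, coeff_sum] at h
  simp only [coeff_monomial] at h
  rw [Finset.sum_ite_eq'] at h
  split_ifs at h with h1
  · exact ⟨h, (Finset.mem_filter.1 h1).2⟩
  · exact absurd h zero_ne_one

lemma coeff_pow (k l n : ℕ) (i : ℕ) (hi : i ≤ n) (hk : 0 < k) :
    coeff (Finsupp.single 0 (k * i) + Finsupp.single 1 (l * (n - i))) ((X 0 ^ k + X 1 ^ l : MvPolynomial (Fin 2) ℂ) ^ n) = (n.choose i : ℂ) := by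
  classical
  have e : ∀ m, (X 0 ^ k : MvPolynomial (Fin 2) ℂ) ^ m * (X 1 ^ l) ^ (n - m) * (n.choose m : MvPolynomial (Fin 2) ℂ) = monomial (Finsupp.single 0 (k * m) + Finsupp.single 1 (l * (n - m))) (n.choose m : ℂ) := by
    intro m
    rw [← pow_mul, ← pow_mul, X_pow_eq_monomial, X_pow_eq_monomial, monomial_mul, ← map_natCast (C : ℂ →+* MvPolynomial (Fin 2) ℂ), mul_comm, C_mul_monomial]
    simp
  rw [add_pow, Finset.sum_congr rfl fun m _ => e m, coeff_sum, Finset.sum_eq_single_of_mem i (Finset.mem_range.2 (by omega))]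
  · rw [coeff_monomial, if_pos rfl]
  · intro m _ hm
    rw [coeff_monomial, if_neg]
    intro h
    have := congrArg (fun f => f 0) h
    simp at this
    omega

end AMS

open MvPolynomial

/-- Proposition 2 of the paper: if `ℂ[x,y]/(q) ≅ ℂ[t]` and the leading
quasi-homogeneous part of `q` with respect to coprime weights `(k, l)`, `k, l ≥ 2`,
is `(x^k + y^l)^n` with `n ≥ 1`, then `n = 1`. -/
theorem leading_part_exponent_one
    (q : MvPolynomial (Fin 2) ℂ)
    (h : Nonempty ((MvPolynomial (Fin 2) ℂ ⧸ Ideal.span {q}) ≃ₐ[ℂ] Polynomial ℂ))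
    (k l n : ℕ) (hk : 2 ≤ k) (hl : 2 ≤ l) (hkl : Nat.Coprime k l) (hn : 0 < n)
    (hlead : leadingPart k l q = (X 0 ^ k + X 1 ^ l) ^ n) :
    n = 1 := by
  
  exfalso
  have c1 := AMS.coeff_pow k l n n le_rfl (by omega)
  have c2 := AMS.coeff_pow k l n 0 (by omega) (by omega)
  rw [← hlead] at c1 c2
  simp only [Nat.sub_self, mul_zero, Finsupp.single_zero, add_zero, zero_add, Nat.sub_zero, Nat.choose_self, Nat.choose_zero_right, Nat.cast_one] at c1 c2
  obtain ⟨d1, w1⟩ := AMS.coeff_leadingPart k l q _ c1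
  obtain ⟨d2, w2⟩ := AMS.coeff_leadingPart k l q _ c2
  refine AMS.main_alg q h k l n hk hl hkl hn ?_ d1 d2
  intro s hs
  have h3 := le_weightedTotalDegree ![l, k] hs
  have h4 : Finsupp.weight ![l, k] s = l * s 0 + k * s 1 := by
    rw [Finsupp.weight_apply, Finsupp.sum_fintype _ _ (by simp)]
    simp [Fin.sum_univ_two, mul_comm]
  rw [h4] at h3
  refine h3.trans (le_of_eq ?_)
  have h5 : wdeg k l q = q.weightedTotalDegree ![l, k] := rfl
  rw [← h5, ← w1, Finsupp.single_apply, Finsupp.single_apply]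
  simp
  ring
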